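/- arXiv:1108.0344 — 3 statements merged into one kernel-verified Lean document; each statement's English description precedes it below -/
import Mathlib

section
/- For every δ > 1 there is a constant C(δ) > 0 such that: if r, g : 2ℤ → [0,∞) satisfy |r|_δ² := Σ_{k∈2ℤ} r(k)²·(log(|k|+e))^δ < ∞ and Σ_{k∈2ℤ} g(k)² < ∞, then for every even N ∈ 2ℕ one has σ₁(N) ≤ C(δ)·|r|_δ·‖g‖ and σ₂(N) ≤ C(δ)·|r|_δ·‖g‖. -/
open scoped BigOperators

/-- `σ₁(N) = Σ_{k∈2ℤ, |k|≤N} Σ_{j∈2ℤ, |j|>N} r(j+k)·g(k)/|j−k|`. -/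
noncomputable def sigma1 (r g : ℤ → ℝ) (N : ℤ) : ℝ :=
  ∑' p : ℤ × ℤ, if Even p.1 ∧ Even p.2 ∧ |p.1| ≤ N ∧ N < |p.2|
    then r (p.2 + p.1) * g p.1 / (|p.2 - p.1| : ℤ) else 0

/-- `σ₂(N) = Σ_{k∈2ℤ, |k|>N} Σ_{j∈2ℤ, |j|≤N} r(j+k)·g(k)/|k−j|`. -/
noncomputable def sigma2 (r g : ℤ → ℝ) (N : ℤ) : ℝ :=
  ∑' p : ℤ × ℤ, if Even p.1 ∧ Even p.2 ∧ N < |p.1| ∧ |p.2| ≤ N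
    then r (p.2 + p.1) * g p.1 / (|p.1 - p.2| : ℤ) else 0

/-- `‖x‖ = (Σ_{k∈2ℤ} x(k)²)^{1/2}`. -/
noncomputable def evenL2Norm (x : ℤ → ℝ) : ℝ :=
  Real.sqrt (∑' k : ℤ, if Even k then x k ^ 2 else 0)

/-- `|x|_δ = (Σ_{k∈2ℤ} x(k)²(log(|k|+e))^δ)^{1/2}`. -/
noncomputable def evenLogNorm (x : ℤ → ℝ) (δ : ℝ) : ℝ :=
  Real.sqrt (∑' k : ℤ, if Even k then x k ^ 2 * Real.log (|k| + Real.exp 1) ^ δ else 0)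

/-- The weight `(log(|k|+e))^δ` defining `evenLogNorm`. -/
noncomputable def logWeight (δ : ℝ) (k : ℤ) : ℝ :=
  Real.log (|k| + Real.exp 1) ^ δ

lemma one_le_log_add_exp_one {x : ℝ} (hx : 0 ≤ x) : 1 ≤ Real.log (x + Real.exp 1) := by
  rw [Real.le_log_iff_exp_le (by positivity)]
  linarith

lemma one_le_logWeight {δ : ℝ} (hδ : 0 ≤ δ) (k : ℤ) : 1 ≤ logWeight δ k :=
  Real.one_le_rpow (one_le_log_add_exp_one (by positivity)) hδ

lemma logWeight_le_logWeight {δ : ℝ} (hδ : 0 ≤ δ) {a b : ℤ} (h : |a| ≤ |b|) :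
    logWeight δ a ≤ logWeight δ b := by
  have h' : ((|a| : ℤ) : ℝ) ≤ ((|b| : ℤ) : ℝ) := by exact_mod_cast h
  have ha : (0 : ℝ) ≤ ((|a| : ℤ) : ℝ) := by positivity
  refine Real.rpow_le_rpow (zero_le_one.trans (one_le_log_add_exp_one ha)) ?_ hδ
  exact Real.log_le_log (by positivity) (by linarith)

lemma summable_inv_mul_logWeight {δ : ℝ} (hδ : 1 < δ) :
    Summable fun n : ℕ => ((n : ℝ) * logWeight δ n)⁻¹ := by
  have hδ0 : 0 ≤ δ := by linarith
  have hW : ∀ k : ℤ, 0 < logWeight δ k := fun k => zero_lt_one.trans_le (one_le_logWeight hδ0 k)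
  rw [← summable_condensed_iff_of_nonneg]
  · have hlog : 0 < Real.log 2 := Real.log_pos (by norm_num)
    have hs : Summable fun n : ℕ => (Real.log 2 ^ δ)⁻¹ * ((n : ℝ) ^ δ)⁻¹ :=
      (Real.summable_nat_rpow_inv.mpr hδ).mul_left _
    rw [← summable_nat_add_iff 1] at hs ⊢
    refine Summable.of_nonneg_of_le (fun n => ?_) (fun n => ?_) hs
    · have := hW ((2 ^ (n + 1) : ℕ) : ℤ)
      positivity
    · have h2 : (0 : ℝ) < 2 ^ (n + 1) := by positivity
      have hle : (Real.log 2 * ((n + 1 : ℕ) : ℝ)) ^ δ ≤ logWeight δ ((2 ^ (n + 1) : ℕ) : ℤ) := by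
        refine Real.rpow_le_rpow (by positivity) ?_ hδ0
        rw [mul_comm, ← Real.log_pow]
        refine Real.log_le_log h2 ?_
        have := Real.exp_pos 1
        simp only [Nat.abs_cast, Int.cast_natCast]
        push_cast
        linarith
      rw [mul_inv, ← mul_assoc]
      push_cast at hle ⊢
      rw [mul_inv_cancel₀ h2.ne', one_mul, ← mul_inv, ← Real.mul_rpow hlog.le (by positivity)]
      exact inv_anti₀ (by positivity) hle
  · intro n
    have := hW n
    positivity
  · intro m n hm hmn
    have hm' : (0 : ℝ) < m := by exact_mod_cast hm
    have hmn' : (m : ℝ) ≤ n := by exact_mod_cast hmn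
    have hw : logWeight δ m ≤ logWeight δ n :=
      logWeight_le_logWeight hδ0 (by simpa using hmn)
    exact inv_anti₀ (mul_pos hm' (hW m)) (mul_le_mul hmn' hw (hW m).le (hm'.le.trans hmn'))

/-- The kernel obtained by applying Cauchy–Schwarz to `sigma1` and `sigma2`. -/
noncomputable def pairKernel (δ : ℝ) (p : ℤ × ℤ) : ℝ :=
  (logWeight δ (p.2 + p.1) * ((p.2 - p.1 : ℤ) : ℝ) ^ 2)⁻¹

lemma pairKernel_swap (δ : ℝ) (p : ℤ × ℤ) : pairKernel δ p.swap = pairKernel δ p := by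
  unfold pairKernel
  rw [Prod.fst_swap, Prod.snd_swap, add_comm p.1]
  push_cast
  ring_nf

/-- The number of pairs `(k, j)` with `|k| ≤ N < |j|` and `|j - k| = d` is at most `2d`
and at most `2(2N+1)`. -/
lemma card_le_of_natAbs_sub_eq {N d : ℕ} {F : Finset (ℤ × ℤ)}
    (hF : ∀ p ∈ F, |p.1| ≤ N ∧ (N : ℤ) < |p.2| ∧ (p.2 - p.1).natAbs = d) :
    F.card ≤ 2 * d ∧ F.card ≤ 2 * (2 * N + 1) := by
  have card_le (s t : Finset ℤ) (hst : ∀ p ∈ F, (p.1 ∈ s ∧ p.2 = p.1 + d) ∨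
      (p.1 ∈ t ∧ p.2 = p.1 - d)) : F.card ≤ s.card + t.card := by
    have hsub : F ⊆ s.image (fun k => (k, k + (d : ℤ))) ∪ t.image (fun k => (k, k - (d : ℤ))) := by
      rintro ⟨k, j⟩ hp
      simp only [Finset.mem_union, Finset.mem_image, Prod.mk.injEq]
      rcases hst _ hp with ⟨h1, h2⟩ | ⟨h1, h2⟩
      · exact Or.inl ⟨k, h1, rfl, h2.symm⟩
      · exact Or.inr ⟨k, h1, rfl, h2.symm⟩
    exact (Finset.card_le_card hsub).trans ((Finset.card_union_le _ _).trans
      (add_le_add Finset.card_image_le Finset.card_image_le))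
  constructor
  · refine (card_le (Finset.Ioc (N - d) N) (Finset.Ico (-N) (-N + d)) fun p hp => ?_).trans ?_
    · have := hF p hp
      simp only [Int.abs_eq_natAbs] at this
      simp only [Finset.mem_Ioc, Finset.mem_Ico]
      omega
    · simp only [Int.card_Ioc, Int.card_Ico]
      omega
  · refine (card_le (Finset.Icc (-N) N) (Finset.Icc (-N) N) fun p hp => ?_).trans ?_
    · have := hF p hp
      simp only [Int.abs_eq_natAbs] at this
      simp only [Finset.mem_Icc]
      omega
    · simp only [Int.card_Icc]
      omega

lemma pairKernel_le_inv_sq {δ : ℝ} (hδ : 0 ≤ δ) (p : ℤ × ℤ) :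
    pairKernel δ p ≤ (((p.2 - p.1).natAbs : ℝ) ^ 2)⁻¹ := by
  have hW := one_le_logWeight hδ (p.2 + p.1)
  have hd : (((p.2 - p.1).natAbs : ℝ)) ^ 2 = ((p.2 - p.1 : ℤ) : ℝ) ^ 2 := by
    rw [Nat.cast_natAbs, Int.cast_abs, sq_abs]
  rw [hd, pairKernel, mul_inv]
  exact mul_le_of_le_one_left (by positivity) (inv_le_one_of_one_le₀ hW)

lemma pairKernel_le_of_natAbs_sub_le {δ : ℝ} (hδ : 0 ≤ δ) {N : ℕ} {p : ℤ × ℤ}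
    (h1 : |p.1| ≤ N) (h2 : (N : ℤ) < |p.2|) (hd : (p.2 - p.1).natAbs ≤ N) :
    pairKernel δ p ≤
      (logWeight δ ((p.2 - p.1).natAbs : ℤ) * ((p.2 - p.1).natAbs : ℝ) ^ 2)⁻¹ := by
  have hd' : (((p.2 - p.1).natAbs : ℝ)) ^ 2 = ((p.2 - p.1 : ℤ) : ℝ) ^ 2 := by
    rw [Nat.cast_natAbs, Int.cast_abs, sq_abs]
  have hW := one_le_logWeight hδ ((p.2 - p.1).natAbs : ℤ)
  rw [hd', pairKernel, mul_inv, mul_inv]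
  refine mul_le_mul_of_nonneg_right (inv_anti₀ (by linarith) ?_) (by positivity)
  exact logWeight_le_logWeight hδ (by simp only [Int.abs_eq_natAbs] at *; omega)

lemma sum_inv_sq_le_of_lt {N : ℕ} {s : Finset ℕ} (hs : ∀ d ∈ s, N < d) :
    ∑ d ∈ s, ((d : ℝ) ^ 2)⁻¹ ≤ 2 / (N + 1) := by
  refine (Finset.sum_le_sum_of_subset_of_nonneg (t := Finset.Ioo N (s.sup id + 1)) ?_ ?_).trans
    (sum_Ioo_inv_sq_le N _)
  · intro d hd
    exact Finset.mem_Ioo.mpr ⟨hs d hd, Nat.lt_succ_of_le (Finset.le_sup (f := id) hd)⟩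
  · intros
    positivity

lemma sum_pairKernel_le {δ : ℝ} (hδ : 1 < δ) {N : ℕ} {F : Finset (ℤ × ℤ)}
    (hF : ∀ p ∈ F, |p.1| ≤ N ∧ (N : ℤ) < |p.2|) :
    ∑ p ∈ F, pairKernel δ p ≤ 2 * ∑' n : ℕ, ((n : ℝ) * logWeight δ n)⁻¹ + 8 := by
  have hδ0 : 0 ≤ δ := by linarith
  have hW (k : ℤ) : 0 < logWeight δ k := zero_lt_one.trans_le (one_le_logWeight hδ0 k)
  let diff : ℤ × ℤ → ℕ := fun p => (p.2 - p.1).natAbs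
  set s := F.image diff
  have fiber_le : ∀ d ∈ s, ∑ p ∈ F with diff p = d, pairKernel δ p ≤
      2 * ((d : ℝ) * logWeight δ d)⁻¹ +
        if N < d then 2 * (2 * (N : ℝ) + 1) * ((d : ℝ) ^ 2)⁻¹ else 0 := by
    intro d hd
    have hfib : ∀ p ∈ F.filter (diff · = d),
        |p.1| ≤ N ∧ (N : ℤ) < |p.2| ∧ (p.2 - p.1).natAbs = d := by
      intro p hp
      rw [Finset.mem_filter] at hp
      exact ⟨(hF p hp.1).1, (hF p hp.1).2, hp.2⟩
    obtain ⟨hc1, hc2⟩ := card_le_of_natAbs_sub_eq hfib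
    have hd0 : (0 : ℝ) < d := by
      obtain ⟨p, hp, hpd⟩ := Finset.mem_image.mp hd
      have := hF p hp
      simp only [Int.abs_eq_natAbs] at this
      have : 0 < d := by simp only [diff] at hpd; omega
      exact_mod_cast this
    have hWd := hW d
    split_ifs with hNd
    · have hsum := Finset.sum_le_card_nsmul _ (pairKernel δ) (((d : ℝ) ^ 2)⁻¹)
        fun p hp => (hfib p hp).2.2 ▸ pairKernel_le_inv_sq hδ0 p
      have hc : ((F.filter (diff · = d)).card : ℝ) ≤ 2 * (2 * (N : ℝ) + 1) := by
        exact_mod_cast hc2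
      rw [nsmul_eq_mul] at hsum
      have := mul_le_mul_of_nonneg_right hc (show 0 ≤ ((d : ℝ) ^ 2)⁻¹ by positivity)
      have : 0 ≤ ((d : ℝ) * logWeight δ d)⁻¹ := by positivity
      linarith
    · have hsum := Finset.sum_le_card_nsmul (F.filter (diff · = d)) (pairKernel δ)
        ((logWeight δ d * (d : ℝ) ^ 2)⁻¹) fun p hp => by
          obtain ⟨h1, h2, h3⟩ := hfib p hp
          have := pairKernel_le_of_natAbs_sub_le hδ0 h1 h2 (by omega)
          rwa [h3] at this
      have hc : ((F.filter (diff · = d)).card : ℝ) ≤ 2 * (d : ℝ) := by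
        exact_mod_cast hc1
      rw [nsmul_eq_mul] at hsum
      refine (hsum.trans (mul_le_mul_of_nonneg_right hc (by positivity))).trans (le_of_eq ?_)
      field_simp
      ring
  calc ∑ p ∈ F, pairKernel δ p
      = ∑ d ∈ s, ∑ p ∈ F with diff p = d, pairKernel δ p :=
        (Finset.sum_fiberwise_of_maps_to (fun p hp => Finset.mem_image_of_mem _ hp) _).symm
    _ ≤ ∑ d ∈ s, (2 * ((d : ℝ) * logWeight δ d)⁻¹ +
          if N < d then 2 * (2 * (N : ℝ) + 1) * ((d : ℝ) ^ 2)⁻¹ else 0) :=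
        Finset.sum_le_sum fiber_le
    _ = 2 * ∑ d ∈ s, ((d : ℝ) * logWeight δ d)⁻¹ +
          2 * (2 * (N : ℝ) + 1) * ∑ d ∈ s with N < d, ((d : ℝ) ^ 2)⁻¹ := by
        rw [Finset.sum_add_distrib, ← Finset.mul_sum, ← Finset.sum_filter, ← Finset.mul_sum]
    _ ≤ 2 * ∑' n : ℕ, ((n : ℝ) * logWeight δ n)⁻¹ + 8 := by
        refine add_le_add (mul_le_mul_of_nonneg_left ?_ zero_le_two) ?_
        · refine (summable_inv_mul_logWeight hδ).sum_le_tsum _ fun n _ => ?_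
          have := hW n
          positivity
        · have h := sum_inv_sq_le_of_lt (N := N) (s := s.filter (N < ·))
            fun d hd => (Finset.mem_filter.mp hd).2
          refine (mul_le_mul_of_nonneg_left h (by positivity)).trans ?_
          rw [← mul_div_assoc, div_le_iff₀ (by positivity)]
          have : (0 : ℝ) ≤ N := by positivity
          linarith

/-- A weighted Cauchy–Schwarz inequality over a finite set of pairs of even integers. -/
lemma sum_le_sqrt_mul_evenLogNorm_mul_evenL2Norm {δ A : ℝ} (hδ : 0 ≤ δ) {r g : ℤ → ℝ}
    (hr : Summable fun k : ℤ =>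
      if Even k then r k ^ 2 * Real.log (|k| + Real.exp 1) ^ δ else 0)
    (hg : Summable fun k : ℤ => if Even k then g k ^ 2 else 0)
    {F : Finset (ℤ × ℤ)} (hF : ∀ p ∈ F, Even p.1 ∧ Even p.2)
    (hA : ∑ p ∈ F, pairKernel δ p ≤ A) :
    ∑ p ∈ F, r (p.2 + p.1) * g p.1 / (|p.2 - p.1| : ℤ) ≤
      Real.sqrt A * evenLogNorm r δ * evenL2Norm g := by
  have hW (k : ℤ) : 0 < logWeight δ k := zero_lt_one.trans_le (one_le_logWeight hδ k)
  set R : ℤ → ℝ := fun k => if Even k then r k ^ 2 * Real.log (|k| + Real.exp 1) ^ δ else 0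
    with hR
  set G : ℤ → ℝ := fun k => if Even k then g k ^ 2 else 0 with hG
  have hR0 : 0 ≤ R := fun k => by
    have := (hW k).le
    simp only [hR, Pi.zero_apply]
    split_ifs
    · exact mul_nonneg (sq_nonneg _) this
    · exact le_rfl
  have hG0 : 0 ≤ G := fun k => by
    simp only [hG, Pi.zero_apply]
    split_ifs <;> positivity
  have hprod : ∑ p ∈ F, (r (p.2 + p.1) * g p.1 * Real.sqrt (logWeight δ (p.2 + p.1))) ^ 2 ≤
      (∑' k, R k) * ∑' k, G k := by
    have hRG := hr.mul_of_nonneg hg hR0 hG0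
    rw [hr.tsum_mul_tsum hg hRG]
    let shear : ℤ × ℤ ↪ ℤ × ℤ := ⟨fun p => (p.2 + p.1, p.1), fun p q h => by
      simp only [Prod.mk.injEq] at h
      ext <;> omega⟩
    refine le_trans (le_of_eq ?_)
      (hRG.sum_le_tsum (F.map shear) fun p _ => mul_nonneg (hR0 p.1) (hG0 p.2))
    rw [Finset.sum_map]
    refine Finset.sum_congr rfl fun p hp => ?_
    obtain ⟨h1, h2⟩ := hF p hp
    change _ = R (p.2 + p.1) * G p.1
    simp only [hR, hG, if_pos h1, if_pos (h2.add h1)]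
    rw [mul_pow, Real.sq_sqrt (hW _).le, logWeight]
    ring
  have hker : ∑ p ∈ F, (Real.sqrt (pairKernel δ p)) ^ 2 ≤ A := by
    refine le_trans (le_of_eq (Finset.sum_congr rfl fun p _ => Real.sq_sqrt ?_)) hA
    have := hW (p.2 + p.1)
    unfold pairKernel
    positivity
  have hterm : ∀ p ∈ F, r (p.2 + p.1) * g p.1 / (|p.2 - p.1| : ℤ) =
      (r (p.2 + p.1) * g p.1 * Real.sqrt (logWeight δ (p.2 + p.1))) *
        Real.sqrt (pairKernel δ p) := by
    intro p _
    have hs := Real.sqrt_pos.mpr (hW (p.2 + p.1))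
    rw [pairKernel, Real.sqrt_inv, Real.sqrt_mul (hW _).le, Real.sqrt_sq_eq_abs, Int.cast_abs,
      mul_inv, mul_assoc, mul_inv_cancel_left₀ hs.ne', div_eq_mul_inv]
  rw [Finset.sum_congr rfl hterm, evenLogNorm, evenL2Norm, mul_assoc,
    ← Real.sqrt_mul (tsum_nonneg hR0), mul_comm]
  refine (Real.sum_mul_le_sqrt_mul_sqrt _ _ _).trans ?_
  gcongr

/-- For every `δ > 1` there is `C(δ) > 0` such that for all nonnegative
sequences `r` with `|r|_δ < ∞` and `g ∈ ℓ²(2ℤ)`, and every even `N ≥ 0`,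
`σ₁(N) ≤ C(δ)|r|_δ‖g‖` and `σ₂(N) ≤ C(δ)|r|_δ‖g‖`. -/
theorem stmt8 (δ : ℝ) (hδ : 1 < δ) :
    ∃ C > 0, ∀ r g : ℤ → ℝ, (∀ k, 0 ≤ r k) → (∀ k, 0 ≤ g k) →
      (Summable fun k : ℤ => if Even k then r k ^ 2 * Real.log (|k| + Real.exp 1) ^ δ else 0) →
      (Summable fun k : ℤ => if Even k then g k ^ 2 else 0) →
      ∀ N : ℤ, 0 ≤ N → Even N →
        sigma1 r g N ≤ C * evenLogNorm r δ * evenL2Norm g ∧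
        sigma2 r g N ≤ C * evenLogNorm r δ * evenL2Norm g := by
  have hδ0 : 0 ≤ δ := by linarith
  set A := 2 * ∑' n : ℕ, ((n : ℝ) * logWeight δ n)⁻¹ + 8
  have hA0 : 0 < A := by
    have : 0 ≤ ∑' n : ℕ, ((n : ℝ) * logWeight δ n)⁻¹ := tsum_nonneg fun n => by
      have := one_le_logWeight hδ0 n
      positivity
    linarith
  refine ⟨Real.sqrt A, Real.sqrt_pos.mpr hA0, fun r g _ _ hr hg N hN _ => ?_⟩
  lift N to ℕ using hN
  have hnonneg : 0 ≤ Real.sqrt A * evenLogNorm r δ * evenL2Norm g := by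
    unfold evenLogNorm evenL2Norm
    positivity
  constructor
  · refine tsum_le_of_sum_le' hnonneg fun F => ?_
    rw [← Finset.sum_filter]
    refine sum_le_sqrt_mul_evenLogNorm_mul_evenL2Norm hδ0 hr hg (fun p hp => ?_)
      (sum_pairKernel_le (N := N) hδ fun p hp => ?_)
    all_goals
      rw [Finset.mem_filter] at hp
      tauto
  · refine tsum_le_of_sum_le' hnonneg fun F => ?_
    rw [← Finset.sum_filter]
    simp only [fun p : ℤ × ℤ => abs_sub_comm p.1 p.2]
    refine sum_le_sqrt_mul_evenLogNorm_mul_evenL2Norm hδ0 hr hg (fun p hp => ?_) ?_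
    · rw [Finset.mem_filter] at hp
      tauto
    · set F' := F.filter fun p => Even p.1 ∧ Even p.2 ∧ (N : ℤ) < |p.1| ∧ |p.2| ≤ (N : ℤ)
      have h := sum_pairKernel_le (N := N) (F := F'.map (Equiv.prodComm ℤ ℤ).toEmbedding) hδ
        fun p hp => by
          obtain ⟨q, hq, rfl⟩ := Finset.mem_map.mp hp
          have := (Finset.mem_filter.mp hq).2
          exact ⟨this.2.2.2, this.2.2.1⟩
      rw [Finset.sum_map] at h
      exact (Finset.sum_congr rfl fun p _ => (pairKernel_swap δ p).symm).trans_le h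
end

section
/- Let r, g : 2ℤ → [0,∞) satisfy Σ_{k∈2ℤ} r(k)² < ∞ and Σ_{k∈2ℤ} g(k)² < ∞, and let m ∈ 2ℤ with m ≠ 0. Then the double sum σ₃ = Σ_{k∈2ℤ, k≠m} Σ_{j∈2ℤ, j≠m} r(j+k)·g(k)/(|m−j|·|m−k|) satisfies σ₃ ≤ 4·‖g‖·(2·‖r‖/√|m| + 𝓔_{|m|}(r)). -/
/-- The truncated inverse: `|z|⁻¹` if `M < |z|`, and `0` otherwise. -/
noncomputable def truncInv (M : ℕ) (z : ℤ) : ℝ :=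
  if M < z.natAbs then (z.natAbs : ℝ)⁻¹ else 0

lemma truncInv_nonneg (M : ℕ) (z : ℤ) : 0 ≤ truncInv M z := by
  unfold truncInv; split_ifs <;> positivity

lemma truncInv_sq (M : ℕ) (z : ℤ) :
    truncInv M z ^ 2 = if M < z.natAbs then ((z.natAbs : ℝ) ^ 2)⁻¹ else 0 := by
  unfold truncInv; split_ifs <;> simp

lemma truncInv_zero_left (z : ℤ) : truncInv 0 z = (z.natAbs : ℝ)⁻¹ := by
  unfold truncInv; split_ifs with h
  · rfl
  · simp at h; simp [h]

/-- Bounds for the partial tails of `∑ n⁻²` over `ℕ` give bounds for the two-sided sum. -/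
lemma truncInv_sq_summable_tsum_le {M : ℕ} {c : ℝ}
    (h : ∀ n, ∑ i ∈ Finset.Ioo M n, ((i : ℝ) ^ 2)⁻¹ ≤ c) :
    Summable (fun z => truncInv M z ^ 2) ∧ ∑' z, truncInv M z ^ 2 ≤ 2 * c := by
  have hv (n : ℕ) : ∑ i ∈ Finset.range n, (if M < i then ((i : ℝ) ^ 2)⁻¹ else 0) ≤ c := by
    rw [← Finset.sum_filter]
    convert h n using 2
    ext i
    simp [and_comm]
  have h0 (i : ℕ) : 0 ≤ (if M < i then ((i : ℝ) ^ 2)⁻¹ else 0) := by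
    split_ifs <;> positivity
  have hs := (summable_of_sum_range_le h0 hv).hasSum
  have hc := Real.tsum_le_of_sum_range_le h0 hv
  have key : HasSum (fun z : ℤ => truncInv M z ^ 2) _ :=
    HasSum.of_nat_of_neg (f := fun z : ℤ => truncInv M z ^ 2)
      (by simpa [truncInv_sq] using hs) (by simpa [truncInv_sq] using hs)
  refine ⟨key.summable, ?_⟩
  rw [key.tsum_eq]
  linarith [sq_nonneg (truncInv M 0)]

lemma truncInv_zero_sq_summable_tsum_le :
    Summable (fun z => truncInv 0 z ^ 2) ∧ ∑' z, truncInv 0 z ^ 2 ≤ 4 := by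
  have := truncInv_sq_summable_tsum_le (M := 0) (c := 2)
    fun n => by simpa using sum_Ioo_inv_sq_le (α := ℝ) 0 n
  norm_num at this ⊢
  exact this

lemma truncInv_sq_summable_tsum_le_inv {M : ℕ} (hM : M ≠ 0) :
    Summable (fun z => truncInv M z ^ 2) ∧ ∑' z, truncInv M z ^ 2 ≤ 2 * (M : ℝ)⁻¹ := by
  refine truncInv_sq_summable_tsum_le fun n => ?_
  rcases le_total M n with h | h
  · refine (Finset.sum_le_sum_of_subset_of_nonneg Finset.Ioo_subset_Ioc_self
      fun _ _ _ => by positivity).trans ((sum_Ioc_inv_sq_le_sub hM h).trans ?_)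
    simp
  · simp [Finset.Ioo_eq_empty_of_le h]

lemma sum_comp_mul_le_tsum_mul_tsum {ι : Type*} {A B : ℤ → ℝ} (hA0 : ∀ i, 0 ≤ A i)
    (hB0 : ∀ i, 0 ≤ B i) (hA : Summable A) (hB : Summable B) {φ : ι → ℤ × ℤ}
    (hφ : Function.Injective φ) (s : Finset ι) :
    ∑ p ∈ s, A (φ p).1 * B (φ p).2 ≤ (∑' i, A i) * ∑' i, B i := by
  have hAB := hA.mul_of_nonneg hB hA0 hB0
  rw [hA.tsum_mul_tsum hB hAB]
  have := hAB.sum_le_tsum (s.map ⟨φ, hφ⟩) fun _ _ => mul_nonneg (hA0 _) (hB0 _)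
  simpa using this

/-- Cauchy–Schwarz for the sums `∑ G(k) u(m - j) · F(j + k) v(m - k)`. -/
lemma sum_mul_comp_le_sqrt {G u F v : ℤ → ℝ} (hG : Summable fun i => G i ^ 2)
    (hu : Summable fun i => u i ^ 2) (hF : Summable fun i => F i ^ 2)
    (hv : Summable fun i => v i ^ 2) (m : ℤ) (s : Finset (ℤ × ℤ)) :
    ∑ p ∈ s, G p.1 * u (m - p.2) * (F (p.2 + p.1) * v (m - p.1)) ≤
      √(∑' i, G i ^ 2) * √(∑' i, u i ^ 2) * (√(∑' i, F i ^ 2) * √(∑' i, v i ^ 2)) := by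
  refine (Real.sum_mul_le_sqrt_mul_sqrt _ _ _).trans ?_
  rw [← Real.sqrt_mul (tsum_nonneg fun _ => sq_nonneg _),
    ← Real.sqrt_mul (tsum_nonneg fun _ => sq_nonneg _)]
  simp only [mul_pow]
  gcongr
  · exact sum_comp_mul_le_tsum_mul_tsum (fun _ => sq_nonneg _) (fun _ => sq_nonneg _) hG hu
      (φ := fun p : ℤ × ℤ => (p.1, m - p.2)) (fun p q h => by
        simp only [Prod.mk.injEq] at h; ext <;> lia) s
  · exact sum_comp_mul_le_tsum_mul_tsum (fun _ => sq_nonneg _) (fun _ => sq_nonneg _) hF hv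
      (φ := fun p : ℤ × ℤ => (p.2 + p.1, m - p.1)) (fun p q h => by
        simp only [Prod.mk.injEq] at h; ext <;> lia) s

/-- The pointwise splitting behind the estimate: if `|j + k| < |m|` then `|m - j|` or `|m - k|`
exceeds `|m| / 2`. -/
lemma term_le_split {r g : ℤ → ℝ} (hr : ∀ k, 0 ≤ r k) (hg : ∀ k, 0 ≤ g k) (m : ℤ) {M : ℕ}
    (hM : m.natAbs = 2 * M) (k j : ℤ) :
    (if Even k ∧ Even j ∧ k ≠ m ∧ j ≠ m
        then r (j + k) * g k / ((|m - j| : ℤ) * (|m - k| : ℤ)) else 0) ≤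
      (if Even k then g k else 0) * truncInv 0 (m - j) *
          ((if Even (j + k) ∧ |m| ≤ |j + k| then r (j + k) else 0) * truncInv 0 (m - k)) +
        (if Even k then g k else 0) * truncInv M (m - j) *
          ((if Even (j + k) then r (j + k) else 0) * truncInv 0 (m - k)) +
        (if Even k then g k else 0) * truncInv 0 (m - j) *
          ((if Even (j + k) then r (j + k) else 0) * truncInv M (m - k)) := by
  have hG : 0 ≤ if Even k then g k else 0 := by split_ifs; exacts [hg _, le_rfl]
  have hR : 0 ≤ if Even (j + k) then r (j + k) else 0 := by split_ifs; exacts [hr _, le_rfl]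
  have hT : 0 ≤ if Even (j + k) ∧ |m| ≤ |j + k| then r (j + k) else 0 := by
    split_ifs; exacts [hr _, le_rfl]
  have t := truncInv_nonneg
  have h1 := mul_nonneg (mul_nonneg hG (t 0 (m - j))) (mul_nonneg hT (t 0 (m - k)))
  have h2 := mul_nonneg (mul_nonneg hG (t M (m - j))) (mul_nonneg hR (t 0 (m - k)))
  have h3 := mul_nonneg (mul_nonneg hG (t 0 (m - j))) (mul_nonneg hR (t M (m - k)))
  by_cases h : Even k ∧ Even j ∧ k ≠ m ∧ j ≠ m
  swap
  · rw [if_neg h]; positivity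
  have hjk : Even (j + k) := h.2.1.add h.1
  have heq : r (j + k) * g k / ((|m - j| : ℤ) * (|m - k| : ℤ)) =
      g k * truncInv 0 (m - j) * (r (j + k) * truncInv 0 (m - k)) := by
    simp only [truncInv_zero_left, Nat.cast_natAbs]
    field_simp
  have hbig (z : ℤ) (hz : M < z.natAbs) : truncInv M z = truncInv 0 z := by
    rw [truncInv_zero_left, truncInv, if_pos hz]
  rw [if_pos h, heq]
  by_cases c1 : |m| ≤ |j + k|
  · simp only [h.1, hjk, c1, and_self, if_true] at h1 h2 h3 ⊢
    linarith
  by_cases c2 : M < (m - j).natAbs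
  · rw [hbig _ c2] at h2 ⊢
    simp only [h.1, hjk, if_true] at h1 h2 h3 ⊢
    linarith
  have c3 : M < (m - k).natAbs := by
    rw [Int.abs_eq_natAbs, Int.abs_eq_natAbs] at c1; lia
  rw [hbig _ c3] at h3 ⊢
  simp only [h.1, hjk, if_true] at h1 h2 h3 ⊢
  linarith

/-- `𝓔_m(x) = (Σ_{j∈2ℤ, |j|≥m} x(j)²)^{1/2}`. -/
noncomputable def evenTail (x : ℤ → ℝ) (m : ℤ) : ℝ :=
  Real.sqrt (∑' j : ℤ, if Even j ∧ m ≤ |j| then x j ^ 2 else 0)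

/-- For nonnegative square-summable `r, g : 2ℤ → [0,∞)` and even `m ≠ 0`,
the double sum `σ₃ = Σ_{k≠m} Σ_{j≠m} r(j+k)g(k)/(|m−j||m−k|)` (over even `j, k`) satisfies
`σ₃ ≤ 4‖g‖(2‖r‖/√|m| + 𝓔_{|m|}(r))`. -/
theorem stmt10 (r g : ℤ → ℝ) (hr : ∀ k, 0 ≤ r k) (hg : ∀ k, 0 ≤ g k)
    (hr2 : Summable fun k : ℤ => if Even k then r k ^ 2 else 0)
    (hg2 : Summable fun k : ℤ => if Even k then g k ^ 2 else 0)
    (m : ℤ) (hm : Even m) (hm0 : m ≠ 0) :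
    (∑' p : ℤ × ℤ, if Even p.1 ∧ Even p.2 ∧ p.1 ≠ m ∧ p.2 ≠ m
        then r (p.2 + p.1) * g p.1 / ((|m - p.2| : ℤ) * (|m - p.1| : ℤ)) else 0) ≤
      4 * evenL2Norm g * (2 * evenL2Norm r / Real.sqrt |(m : ℝ)| + evenTail r |m|) := by
  obtain ⟨M, hM⟩ : ∃ M, m.natAbs = 2 * M := by
    obtain ⟨a, rfl⟩ := hm
    exact ⟨a.natAbs, by lia⟩
  have hM0 : M ≠ 0 := by lia
  have hmM : |(m : ℝ)| = 2 * M := by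
    rw [← Int.cast_abs, ← Nat.cast_natAbs, hM]; push_cast; rfl
  have eG : (fun i => (if Even i then g i else 0) ^ 2) = fun i => if Even i then g i ^ 2 else 0 := by
    ext; split_ifs <;> simp
  have eR : (fun i => (if Even i then r i else 0) ^ 2) = fun i => if Even i then r i ^ 2 else 0 := by
    ext; split_ifs <;> simp
  have eT : (fun i => (if Even i ∧ |m| ≤ |i| then r i else 0) ^ 2) =
      fun i => if Even i ∧ |m| ≤ |i| then r i ^ 2 else 0 := by
    ext; split_ifs <;> simp
  have hT2 : Summable fun i => if Even i ∧ |m| ≤ |i| then r i ^ 2 else 0 := by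
    refine hr2.of_nonneg_of_le (fun i => ?_) fun i => ?_
    · split_ifs <;> positivity
    · split_ifs with h1 h2 h2
      · rfl
      · exact absurd h1.1 h2
      · positivity
      · rfl
  obtain ⟨hw, hw4⟩ := truncInv_zero_sq_summable_tsum_le
  obtain ⟨hwM, hwM'⟩ := truncInv_sq_summable_tsum_le_inv hM0
  have b0 : √(∑' z, truncInv 0 z ^ 2) ≤ 2 := Real.sqrt_le_iff.2 ⟨by norm_num, by linarith⟩
  have bM : √(∑' z, truncInv M z ^ 2) ≤ 2 / √|(m : ℝ)| := by
    refine Real.sqrt_le_iff.2 ⟨by positivity, hwM'.trans_eq ?_⟩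
    rw [div_pow, Real.sq_sqrt (abs_nonneg _), hmM]
    field_simp
  refine Real.tsum_le_of_sum_le (fun p => ?_) fun s => ?_
  · have := hr (p.2 + p.1)
    have := hg p.1
    split_ifs <;> positivity
  rw [← eG] at hg2
  rw [← eR] at hr2
  rw [← eT] at hT2
  refine (Finset.sum_le_sum fun p _ => term_le_split hr hg m hM p.1 p.2).trans ?_
  rw [Finset.sum_add_distrib, Finset.sum_add_distrib]
  have s1 := sum_mul_comp_le_sqrt hg2 hw hT2 hw m s
  have s2 := sum_mul_comp_le_sqrt hg2 hwM hr2 hw m s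
  have s3 := sum_mul_comp_le_sqrt hg2 hw hr2 hwM m s
  rw [eG] at s1 s2 s3
  rw [eR] at s2 s3
  rw [eT] at s1
  refine (add_le_add (add_le_add s1 s2) s3).trans ?_
  change evenL2Norm g * _ * (evenTail r |m| * _) + evenL2Norm g * _ * (evenL2Norm r * _) +
    evenL2Norm g * _ * (evenL2Norm r * _) ≤ _
  have hg0 : 0 ≤ evenL2Norm g := Real.sqrt_nonneg _
  have hr0 : 0 ≤ evenL2Norm r := Real.sqrt_nonneg _
  have ht0 : 0 ≤ evenTail r |m| := Real.sqrt_nonneg _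
  calc _ ≤ evenL2Norm g * 2 * (evenTail r |m| * 2) +
        evenL2Norm g * (2 / √|(m : ℝ)|) * (evenL2Norm r * 2) +
        evenL2Norm g * 2 * (evenL2Norm r * (2 / √|(m : ℝ)|)) := by gcongr
    _ = _ := by ring
end

section
/- Let f, g : [0,π] → ℂ be functions of bounded variation that are continuous at 0 and at π. For x ∈ [0,π] and M ∈ ℕ consider the symmetric partial sums S_M(x) = Σ_{m∈2ℤ, |m|≤M} Σ_{ν=1}^{2} ⟨(f,g), φ̃_m^ν⟩·φ_m^ν(x). Then as M → ∞ the sums S_M(x) converge for every x ∈ [0,π], with limit (f̃(x), g̃(x)) given as follows. For x ∈ (0,π): f̃(x) = (f(x−0) + f(x+0))/2 and g̃(x) = (g(x−0) + g(x+0))/2, where f(x∓0) denote the one-sided limits (which exist since f, g have bounded variation). At the endpoints: f̃(0) = ½·(f(0) − b·f(π) − a·g(0)), g̃(0) = ½·((d/(bc−ad))·f(0) + g(0) − (b/(bc−ad))·g(π)), f̃(π) = ½·(−(c/(bc−ad))·f(0) + f(π) + (a/(bc−ad))·g(π)), g̃(π) = ½·(−d·f(π) − c·g(0) + g(π)). Moreover,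 if f and g are continuous on [0,π] and satisfy the boundary conditions f(0) + b·f(π) + a·g(0) = 0 and d·f(π) + c·g(0) + g(π) = 0, then the convergence of S_M to (f, g) is uniform on [0,π]. -/
open MeasureTheory Complex Real Filter
open scoped Topology BigOperators

/-- The eigenfunctions `φ_m^ν` (for even `m ∈ ℤ`):
`φ_m¹(x) = (α₁ e^{iτ₁(π−x)} e^{−imx}, α₂ e^{iτ₁x} e^{imx})`,
`φ_m²(x) = (β₁ e^{iτ₂(π−x)} e^{−imx}, β₂ e^{iτ₂x} e^{imx})`. -/
noncomputable def phiSR (α₁ α₂ β₁ β₂ τ₁ τ₂ : ℂ) (ν : Fin 2) (m : ℤ) (x : ℝ) : ℂ × ℂ :=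
  if ν = 0 then
    (α₁ * Complex.exp (Complex.I * τ₁ * ((Real.pi : ℂ) - x)) * Complex.exp (-Complex.I * m * x),
     α₂ * Complex.exp (Complex.I * τ₁ * x) * Complex.exp (Complex.I * m * x))
  else
    (β₁ * Complex.exp (Complex.I * τ₂ * ((Real.pi : ℂ) - x)) * Complex.exp (-Complex.I * m * x),
     β₂ * Complex.exp (Complex.I * τ₂ * x) * Complex.exp (Complex.I * m * x))

/-- The biorthogonal functions `φ̃_m^η` (for even `m ∈ ℤ`). -/
noncomputable def phitSR (α₁' α₂' β₁' β₂' τ₁ τ₂ : ℂ) (η : Fin 2) (m : ℤ) (x : ℝ) : ℂ × ℂ :=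
  if η = 0 then
    ((starRingEnd ℂ) α₁' * Complex.exp (Complex.I * (starRingEnd ℂ) τ₁ * ((Real.pi : ℂ) - x)) *
        Complex.exp (-Complex.I * m * x),
     (starRingEnd ℂ) α₂' * Complex.exp (Complex.I * (starRingEnd ℂ) τ₁ * x) *
        Complex.exp (Complex.I * m * x))
  else
    ((starRingEnd ℂ) β₁' * Complex.exp (Complex.I * (starRingEnd ℂ) τ₂ * ((Real.pi : ℂ) - x)) *
        Complex.exp (-Complex.I * m * x),
     (starRingEnd ℂ) β₂' * Complex.exp (Complex.I * (starRingEnd ℂ) τ₂ * x) *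
        Complex.exp (Complex.I * m * x))

/-- The pairing `⟨(f,g), (h₁,h₂)⟩ = (1/π)∫₀^π (f·conj h₁ + g·conj h₂)`. -/
noncomputable def pairSR (f g : ℝ → ℂ) (h : ℝ → ℂ × ℂ) : ℂ :=
  (1 / (Real.pi : ℂ)) * ∫ x in (0 : ℝ)..Real.pi,
    (f x * (starRingEnd ℂ) (h x).1 + g x * (starRingEnd ℂ) (h x).2)

/-- The symmetric partial sum
`S_M(x) = Σ_{m∈2ℤ, |m|≤M} Σ_{ν=1,2} ⟨(f,g), φ̃_m^ν⟩ φ_m^ν(x)`. -/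
noncomputable def SMsum (α₁ α₂ β₁ β₂ α₁' α₂' β₁' β₂' τ₁ τ₂ : ℂ) (f g : ℝ → ℂ)
    (M : ℕ) (x : ℝ) : ℂ × ℂ :=
  ∑ m ∈ Finset.Icc (-(M : ℤ)) (M : ℤ),
    if Even m then
      pairSR f g (phitSR α₁' α₂' β₁' β₂' τ₁ τ₂ 0 m) • phiSR α₁ α₂ β₁ β₂ τ₁ τ₂ 0 m x +
      pairSR f g (phitSR α₁' α₂' β₁' β₂' τ₁ τ₂ 1 m) • phiSR α₁ α₂ β₁ β₂ τ₁ τ₂ 1 m x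
    else 0

/-- Hardy's Tauberian theorem, uniformly on a set: Cesàro convergence together with increments of
order `1 / n` forces convergence. -/
theorem tendstoUniformlyOn_of_cesaro {X : Type*} {S : Set X} {a : ℕ → X → ℂ} {s : X → ℂ} {C : ℝ}
    (hstep : ∀ n, ∀ x ∈ S, ‖a (n + 1) x - a n x‖ ≤ C / (n + 1))
    (hces : ∀ ε > 0, ∃ N₀ : ℕ, ∀ N ≥ N₀, ∀ x ∈ S,
      ‖∑ n ∈ Finset.range N, (a n x - s x)‖ ≤ ε * N) :
    TendstoUniformlyOn a s atTop S := by
  rw [Metric.tendstoUniformlyOn_iff]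
  intro ε hε
  obtain ⟨q, hq⟩ := exists_nat_gt (4 * |C| / ε)
  have hq0 : (0 : ℝ) < q := lt_of_le_of_lt (by positivity) hq
  obtain ⟨N₀, hN₀⟩ := hces (ε / (4 * (2 * q + 1))) (by positivity)
  filter_upwards [eventually_ge_atTop (max N₀ (max q 1))] with N hN x hx
  have hNN : N₀ ≤ N := le_trans (le_max_left _ _) hN
  have hNq : q ≤ N := le_trans (le_trans (le_max_left _ _) (le_max_right _ _)) hN
  have hN1 : 1 ≤ N := le_trans (le_trans (le_max_right _ _) (le_max_right _ _)) hN
  have hNqR : (q : ℝ) ≤ N := by exact_mod_cast hNq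
  have hN0 : (0 : ℝ) < N := by exact_mod_cast hN1
  set L : ℕ := N / q + 1 with hL
  have hqn : 0 < q := by exact_mod_cast hq0
  have hLlow : (N : ℝ) ≤ q * L := by
    have : N < q * (N / q + 1) := Nat.lt_mul_div_succ N hqn
    exact_mod_cast this.le
  have hLup : (q : ℝ) * L ≤ 2 * N := by
    have h1 : q * (N / q) ≤ N := Nat.mul_div_le N q
    have : q * L ≤ 2 * N := by rw [hL, mul_add]; omega
    exact_mod_cast this
  have hL0 : (0 : ℝ) < L := by rw [hL]; positivity
  have hCn : 0 ≤ C := by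
    have := (norm_nonneg _).trans (hstep 0 x hx)
    simpa using this
  have hdrift : ∀ j : ℕ, ‖a (N + j) x - a N x‖ ≤ C / N * j := by
    intro j
    induction j with
    | zero => simp
    | succ j ih =>
      have h1 := hstep (N + j) x hx
      have h2 : C / (((N + j : ℕ) : ℝ) + 1) ≤ C / N := by
        apply div_le_div_of_nonneg_left hCn hN0
        push_cast
        have : (0 : ℝ) ≤ j := j.cast_nonneg
        linarith
      calc ‖a (N + (j + 1)) x - a N x‖
          = ‖(a (N + j + 1) x - a (N + j) x) + (a (N + j) x - a N x)‖ := by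
            congr 1; rw [← add_assoc]; ring
        _ ≤ C / N + C / N * j := (norm_add_le _ _).trans (add_le_add (h1.trans h2) ih)
        _ = C / N * ((j + 1 : ℕ) : ℝ) := by push_cast; ring
  have hsplit : (L : ℂ) * (a N x - s x) =
      (∑ n ∈ Finset.range (N + L), (a n x - s x)) - (∑ n ∈ Finset.range N, (a n x - s x))
        - ∑ j ∈ Finset.range L, (a (N + j) x - a N x) := by
    rw [Finset.sum_range_add]
    simp only [Finset.sum_sub_distrib, Finset.sum_const, Finset.card_range, nsmul_eq_mul]
    ring
  have hsum : ‖∑ j ∈ Finset.range L, (a (N + j) x - a N x)‖ ≤ L * (C / N * L) := by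
    refine (norm_sum_le_of_le _ (f := fun j => a (N + j) x - a N x)
      (n := fun _ => C / N * L) ?_).trans (by simp)
    intro j hj
    refine (hdrift j).trans ?_
    have : (j : ℝ) ≤ L := by exact_mod_cast (Finset.mem_range.mp hj).le
    gcongr
  set η := ε / (4 * (2 * (q : ℝ) + 1)) with hη
  have hη0 : 0 < η := by positivity
  have h1 := hN₀ (N + L) (hNN.trans (Nat.le_add_right _ _)) x hx
  have h2 := hN₀ N hNN x hx
  have hmain : L * ‖a N x - s x‖ ≤ η * (N + L) + η * N + L * (C / N * L) := by
    have : (L : ℝ) * ‖a N x - s x‖ = ‖(L : ℂ) * (a N x - s x)‖ := by simp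
    rw [this, hsplit]
    refine (norm_sub_le _ _).trans (add_le_add ((norm_sub_le _ _).trans (add_le_add ?_ h2)) hsum)
    simpa using h1
  have hb1 : η * (N + L) + η * N ≤ L * (ε / 4) := by
    have h3 : (N + L + N : ℝ) ≤ (2 * q + 1) * L := by nlinarith
    have : ε / 4 = η * (2 * q + 1) := by rw [hη]; field_simp
    rw [this]
    nlinarith
  have hb2 : C / N * L < ε / 2 := by
    rw [abs_of_nonneg hCn, div_lt_iff₀ hε] at hq
    have h5 : C * L * q ≤ C * (2 * N) := by nlinarith
    rw [div_mul_eq_mul_div, div_lt_iff₀ hN0]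
    have : C * L * q < ε / 2 * N * q := by nlinarith
    exact lt_of_mul_lt_mul_right this hq0.le
  rw [dist_comm, dist_eq_norm]
  have : L * ‖a N x - s x‖ < L * ε := by nlinarith
  exact lt_of_mul_lt_mul_left this hL0.le

theorem BoundedVariationOn.add_complex {f g : ℝ → ℂ} {s : Set ℝ} (hf : BoundedVariationOn f s)
    (hg : BoundedVariationOn g s) : BoundedVariationOn (fun x => f x + g x) s := by
  refine ne_top_of_le_ne_top (ENNReal.add_ne_top.2 ⟨hf, hg⟩) (iSup_le ?_)
  rintro ⟨n, u, hu, us⟩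
  calc ∑ i ∈ Finset.range n, edist (f (u (i + 1)) + g (u (i + 1))) (f (u i) + g (u i))
      ≤ ∑ i ∈ Finset.range n,
          (edist (f (u (i + 1))) (f (u i)) + edist (g (u (i + 1))) (g (u i))) :=
        Finset.sum_le_sum fun i _ => edist_add_add_le _ _ _ _
    _ ≤ eVariationOn f s + eVariationOn g s := by
        rw [Finset.sum_add_distrib]
        exact add_le_add (eVariationOn.sum_le hu us) (eVariationOn.sum_le hu us)

theorem BoundedVariationOn.intervalIntegrable_complex {f : ℝ → ℂ} {a b : ℝ} (hab : a ≤ b)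
    (hf : BoundedVariationOn f (Set.Icc a b)) : IntervalIntegrable f volume a b := by
  have key : ∀ g : ℝ → ℝ, BoundedVariationOn g (Set.Icc a b) →
      IntervalIntegrable g volume a b := by
    intro g hg
    obtain ⟨p, q, hp, hq, rfl⟩ := hg.locallyBoundedVariationOn.exists_monotoneOn_sub_monotoneOn
    rw [← Set.uIcc_of_le hab] at hp hq
    exact hp.intervalIntegrable.sub hq.intervalIntegrable
  have hre := key _ (Complex.reCLM.lipschitz.comp_boundedVariationOn hf)
  have him := key _ (Complex.imCLM.lipschitz.comp_boundedVariationOn hf)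
  rw [intervalIntegrable_iff_integrableOn_Ioc_of_le hab] at hre him ⊢
  refine (Integrable.add (Integrable.ofReal (𝕜 := ℂ) hre)
    ((Integrable.ofReal (𝕜 := ℂ) him).mul_const Complex.I)).congr (Eventually.of_forall fun x => ?_)
  simp [Complex.re_add_im]

/-- The Fourier coefficient of `h` on `[0, π]` against `exp (2 i k t)`. -/
noncomputable def expCoeff (h : ℝ → ℂ) (k : ℤ) : ℂ :=
  1 / (Real.pi : ℂ) * ∫ t in (0 : ℝ)..Real.pi, h t * Complex.exp (2 * Complex.I * k * t)

/-- The symmetric partial sums of the Fourier series of `h` on `[0, π]`. -/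
noncomputable def expSum (h : ℝ → ℂ) (n : ℕ) (x : ℝ) : ℂ :=
  ∑ k ∈ Finset.Icc (-(n : ℤ)) n, expCoeff h k * Complex.exp (-(2 * Complex.I * k * x))

theorem norm_exp_two_I_int_mul (k : ℤ) (t : ℝ) : ‖Complex.exp (2 * Complex.I * k * t)‖ = 1 := by
  have : 2 * Complex.I * k * t = ((2 * k * t : ℝ) : ℂ) * Complex.I := by push_cast; ring
  rw [this, Complex.norm_exp_ofReal_mul_I]

theorem norm_exp_neg_two_I_int_mul (k : ℤ) (t : ℝ) :
    ‖Complex.exp (-(2 * Complex.I * k * t))‖ = 1 := by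
  rw [Complex.exp_neg, norm_inv, norm_exp_two_I_int_mul, inv_one]

theorem intervalIntegrable_mul_exp {h : ℝ → ℂ} {a b : ℝ} (hh : IntervalIntegrable h volume a b)
    (k : ℤ) :
    IntervalIntegrable (fun t : ℝ => h t * Complex.exp (2 * Complex.I * k * t)) volume a b :=
  hh.mul_continuousOn (by fun_prop)

/-- The Fourier coefficients of a function of bounded variation decay like `1 / |k|`. -/
theorem BoundedVariationOn.norm_expCoeff_le {h : ℝ → ℂ}
    (hh : BoundedVariationOn h (Set.Icc 0 Real.pi)) {k : ℤ} (hk : k ≠ 0) :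
    ‖expCoeff h k‖ ≤ (eVariationOn h (Set.Icc 0 Real.pi)).toReal / |(k : ℝ)| := by
  have hπ := Real.pi_pos
  set n := k.natAbs with hn
  have hn0 : 0 < n := Int.natAbs_pos.2 hk
  have hnR : (0 : ℝ) < n := by exact_mod_cast hn0
  have habs : |(k : ℝ)| = n := by rw [hn, Nat.cast_natAbs, Int.cast_abs]
  set I : ℕ → ℝ := fun j => j * (Real.pi / n) with hI
  have hmono : Monotone I := fun i j hij => by
    simp only [hI]; gcongr
  have hI0 : I 0 = 0 := by simp [hI]
  have hIn : I n = Real.pi := by simp only [hI]; field_simp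
  have hstep : ∀ j, I (j + 1) - I j = Real.pi / n := fun j => by
    simp only [hI]; push_cast; ring
  have hsub : ∀ j ∈ Finset.range n, Set.Icc (I j) (I (j + 1)) ⊆ Set.Icc 0 Real.pi := by
    intro j hj
    rw [← hI0, ← hIn]
    exact Set.Icc_subset_Icc (hmono (Nat.zero_le _)) (hmono (Finset.mem_range.mp hj))
  have hInt : ∀ j ∈ Finset.range n, IntervalIntegrable h volume (I j) (I (j + 1)) := fun j hj =>
    (hh.mono (hsub j hj)).intervalIntegrable_complex (hmono (Nat.le_succ j))
  have hzero : ∀ j, ∫ t in (I j)..(I (j + 1)), Complex.exp (2 * Complex.I * k * t) = 0 := by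
    intro j
    have hc : 2 * Complex.I * (k : ℂ) ≠ 0 := by
      simp [Complex.I_ne_zero, hk]
    rw [integral_exp_mul_complex hc, div_eq_zero_iff]
    left
    rw [sub_eq_zero, Complex.exp_eq_exp_iff_exists_int]
    have hnC : (n : ℂ) ≠ 0 := by exact_mod_cast hn0.ne'
    rcases Int.natAbs_eq k with hk' | hk'
    · refine ⟨1, ?_⟩
      have : (k : ℂ) = n := by rw [hk']; simp [hn]
      rw [this]; simp only [hI]; push_cast; field_simp
    · refine ⟨-1, ?_⟩
      have : (k : ℂ) = -n := by rw [hk']; simp [hn]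
      rw [this]; simp only [hI]; push_cast; field_simp; ring
  have hpiece : ∀ j ∈ Finset.range n,
      ‖∫ t in (I j)..(I (j + 1)), h t * Complex.exp (2 * Complex.I * k * t)‖ ≤
        (eVariationOn h (Set.Icc (I j) (I (j + 1)))).toReal * (Real.pi / n) := by
    intro j hj
    have hle : I j ≤ I (j + 1) := hmono (Nat.le_succ j)
    have hBV := hh.mono (hsub j hj)
    have heq : ∫ t in (I j)..(I (j + 1)), h t * Complex.exp (2 * Complex.I * k * t) =
        ∫ t in (I j)..(I (j + 1)), (h t - h (I j)) * Complex.exp (2 * Complex.I * k * t) := by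
      simp only [sub_mul]
      rw [intervalIntegral.integral_sub (intervalIntegrable_mul_exp (hInt j hj) k)
        (Continuous.intervalIntegrable (by fun_prop) _ _), intervalIntegral.integral_const_mul,
        hzero, mul_zero, sub_zero]
    rw [heq]
    refine (intervalIntegral.norm_integral_le_of_norm_le_const
      (C := (eVariationOn h (Set.Icc (I j) (I (j + 1)))).toReal) ?_).trans ?_
    · intro t ht
      rw [Set.uIoc_of_le hle] at ht
      rw [norm_mul, norm_exp_two_I_int_mul, mul_one, ← dist_eq_norm]
      exact hBV.dist_le (Set.Ioc_subset_Icc_self ht) (Set.left_mem_Icc.2 hle)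
    · rw [hstep, abs_of_pos (by positivity)]
  have htotal : ‖∫ t in (0 : ℝ)..Real.pi, h t * Complex.exp (2 * Complex.I * k * t)‖ ≤
      (eVariationOn h (Set.Icc 0 Real.pi)).toReal * (Real.pi / n) := by
    have hs := intervalIntegral.sum_integral_adjacent_intervals (μ := volume) (a := I) (n := n)
      (f := fun t : ℝ => h t * Complex.exp (2 * Complex.I * k * t))
      (fun j hj => intervalIntegrable_mul_exp (hInt j (Finset.mem_range.2 hj)) k)
    rw [hI0, hIn] at hs
    rw [← hs]
    refine (norm_sum_le_of_le _ hpiece).trans (le_of_eq ?_)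
    rw [← Finset.sum_mul, ← ENNReal.toReal_sum fun j hj => hh.mono (hsub j hj),
      eVariationOn.sum' h hmono, hI0, hIn]
  rw [expCoeff, habs, norm_mul, norm_div, norm_one, Complex.norm_real, Real.norm_of_nonneg hπ.le]
  calc 1 / Real.pi * _ ≤ 1 / Real.pi * ((eVariationOn h (Set.Icc 0 Real.pi)).toReal *
        (Real.pi / n)) := by gcongr
    _ = _ := by field_simp

/-- The `π`-periodic Dirichlet kernel `∑_{|k| ≤ n} exp (2 i k u)`. -/
noncomputable def dirichletKer (n : ℕ) (u : ℝ) : ℝ :=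
  1 + ∑ k ∈ Finset.range n, 2 * Real.cos (2 * (k + 1) * u)

/-- The (unnormalised) `π`-periodic Fejér kernel. -/
noncomputable def fejerKer (N : ℕ) (u : ℝ) : ℝ := ∑ n ∈ Finset.range N, dirichletKer n u

theorem continuous_dirichletKer (n : ℕ) : Continuous (dirichletKer n) := by
  unfold dirichletKer; fun_prop

theorem continuous_fejerKer (N : ℕ) : Continuous (fejerKer N) :=
  continuous_finsetSum _ fun n _ => continuous_dirichletKer n

theorem dirichletKer_neg (n : ℕ) (u : ℝ) : dirichletKer n (-u) = dirichletKer n u := by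
  simp [dirichletKer]

theorem periodic_dirichletKer (n : ℕ) : Function.Periodic (dirichletKer n) Real.pi := by
  intro u
  simp only [dirichletKer]
  congr 1
  refine Finset.sum_congr rfl fun k _ => ?_
  have : 2 * ((k : ℝ) + 1) * (u + Real.pi) = 2 * (k + 1) * u + ((k + 1 : ℕ) : ℝ) * (2 * Real.pi) := by
    push_cast; ring
  rw [this, Real.cos_add_nat_mul_two_pi]

theorem sin_mul_dirichletKer (n : ℕ) (u : ℝ) :
    Real.sin u * dirichletKer n u = Real.sin ((2 * n + 1) * u) := by
  induction n with
  | zero => simp [dirichletKer]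
  | succ n ih =>
    have h : dirichletKer (n + 1) u = dirichletKer n u + 2 * Real.cos (2 * (n + 1) * u) := by
      simp only [dirichletKer, Finset.sum_range_succ]; ring
    rw [h, mul_add, ih]
    have h1 : (2 * (n : ℝ) + 1) * u = 2 * (n + 1) * u - u := by ring
    have h2 : (2 * ((n + 1 : ℕ) : ℝ) + 1) * u = 2 * (n + 1) * u + u := by push_cast; ring
    rw [h1, h2, Real.sin_sub, Real.sin_add]
    ring

theorem sin_sq_mul_fejerKer (N : ℕ) (u : ℝ) :
    Real.sin u ^ 2 * fejerKer N u = Real.sin (N * u) ^ 2 := by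
  induction N with
  | zero => simp [fejerKer]
  | succ N ih =>
    have h : fejerKer (N + 1) u = fejerKer N u + dirichletKer N u := by
      simp only [fejerKer, Finset.sum_range_succ]
    rw [h, mul_add, ih, sq (Real.sin u), mul_assoc, sin_mul_dirichletKer]
    have h1 : (2 * (N : ℝ) + 1) * u = 2 * (N * u) + u := by ring
    have h2 : ((N + 1 : ℕ) : ℝ) * u = N * u + u := by push_cast; ring
    rw [h1, h2, Real.sin_add, Real.sin_add, Real.sin_two_mul, Real.cos_two_mul]
    linear_combination Real.sin u ^ 2 * Real.sin_sq_add_cos_sq (N * u) -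
      Real.sin (N * u) ^ 2 * Real.sin_sq_add_cos_sq u

theorem fejerKer_nonneg {N : ℕ} {u : ℝ} (hu : 0 < Real.sin u) : 0 ≤ fejerKer N u := by
  have h := sin_sq_mul_fejerKer N u
  exact nonneg_of_mul_nonneg_right (h ▸ sq_nonneg _) (pow_pos hu 2)

theorem fejerKer_le {N : ℕ} {u : ℝ} (hu : 0 < Real.sin u) :
    fejerKer N u ≤ 1 / Real.sin u ^ 2 := by
  rw [le_div_iff₀ (pow_pos hu 2), mul_comm, sin_sq_mul_fejerKer]
  exact Real.sin_sq_le_one _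

theorem integral_dirichletKer (n : ℕ) :
    ∫ u in (0 : ℝ)..(Real.pi / 2), dirichletKer n u = Real.pi / 2 := by
  simp only [dirichletKer]
  rw [intervalIntegral.integral_add (by simp)
    (Continuous.intervalIntegrable (by fun_prop) _ _), intervalIntegral.integral_finsetSum
    fun i _ => Continuous.intervalIntegrable (by fun_prop) _ _]
  rw [Finset.sum_eq_zero]
  · simp
  · intro k _
    have hk : (2 * ((k : ℝ) + 1)) ≠ 0 := by positivity
    rw [intervalIntegral.integral_const_mul, intervalIntegral.integral_comp_mul_left _ hk,
      integral_cos]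
    have : 2 * ((k : ℝ) + 1) * (Real.pi / 2) = ((k + 1 : ℕ) : ℝ) * Real.pi := by push_cast; ring
    rw [this, Real.sin_nat_mul_pi]
    simp

theorem integral_fejerKer (N : ℕ) :
    ∫ u in (0 : ℝ)..(Real.pi / 2), fejerKer N u = N * (Real.pi / 2) := by
  simp only [fejerKer]
  rw [intervalIntegral.integral_finsetSum
    fun i _ => (continuous_dirichletKer i).intervalIntegrable _ _]
  simp [integral_dirichletKer]

theorem sum_Icc_neg_succ {M : Type*} [AddCommMonoid M] (F : ℤ → M) (n : ℕ) :
    ∑ k ∈ Finset.Icc (-((n + 1 : ℕ) : ℤ)) ((n + 1 : ℕ) : ℤ), F k =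
      (∑ k ∈ Finset.Icc (-(n : ℤ)) n, F k) + (F (n + 1) + F (-(n + 1))) := by
  have h : Finset.Icc (-((n + 1 : ℕ) : ℤ)) ((n + 1 : ℕ) : ℤ) =
      Finset.Icc (-(n : ℤ)) n ∪ {((n : ℤ) + 1), -((n : ℤ) + 1)} := by
    ext k; simp only [Finset.mem_union, Finset.mem_Icc, Finset.mem_insert, Finset.mem_singleton]
    push_cast; omega
  rw [h, Finset.sum_union, Finset.sum_pair (by omega)]
  rw [Finset.disjoint_left]
  intro k hk
  simp only [Finset.mem_Icc, Finset.mem_insert, Finset.mem_singleton] at hk ⊢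
  omega

theorem sum_exp_eq_dirichletKer (n : ℕ) (u : ℝ) :
    ∑ k ∈ Finset.Icc (-(n : ℤ)) n, Complex.exp (2 * Complex.I * k * u) = dirichletKer n u := by
  induction n with
  | zero => simp [dirichletKer]
  | succ n ih =>
    have h : dirichletKer (n + 1) u = dirichletKer n u + 2 * Real.cos (2 * (n + 1) * u) := by
      simp only [dirichletKer, Finset.sum_range_succ]; ring
    rw [sum_Icc_neg_succ, ih, h]
    push_cast
    rw [Complex.two_cos]
    congr 2 <;> congr 1 <;> ring

theorem expSum_eq_integral {h : ℝ → ℂ} (hh : IntervalIntegrable h volume 0 Real.pi)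
    (n : ℕ) (x : ℝ) :
    expSum h n x =
      1 / (Real.pi : ℂ) * ∫ t in (0 : ℝ)..Real.pi, h t * (dirichletKer n (t - x) : ℂ) := by
  have : ∀ t : ℝ, h t * (dirichletKer n (t - x) : ℂ) = ∑ k ∈ Finset.Icc (-(n : ℤ)) n,
      h t * Complex.exp (2 * Complex.I * k * t) * Complex.exp (-(2 * Complex.I * k * x)) := by
    intro t
    rw [← sum_exp_eq_dirichletKer, Finset.mul_sum]
    refine Finset.sum_congr rfl fun k _ => ?_
    rw [mul_assoc (h t), ← Complex.exp_add]
    congr 2; push_cast; ring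
  simp only [this]
  rw [intervalIntegral.integral_finsetSum
    fun k _ => (intervalIntegrable_mul_exp hh k).mul_const _, Finset.mul_sum, expSum]
  refine Finset.sum_congr rfl fun k _ => ?_
  rw [intervalIntegral.integral_mul_const, expCoeff, mul_assoc]

/-- The Dirichlet integral of a periodic function, folded onto `[0, π / 2]`. -/
theorem expSum_eq_half_integral {H : ℝ → ℂ} (hper : Function.Periodic H Real.pi)
    (hInt : IntervalIntegrable H volume 0 Real.pi) (n : ℕ) (x : ℝ) :
    expSum H n x = 1 / (Real.pi : ℂ) *
      ∫ u in (0 : ℝ)..(Real.pi / 2), (H (x + u) + H (x - u)) * (dirichletKer n u : ℂ) := by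
  have hI : ∀ a b, IntervalIntegrable H volume a b :=
    hper.intervalIntegrable₀ Real.pi_ne_zero hInt
  have hcont : Continuous fun u : ℝ => (dirichletKer n u : ℂ) :=
    Complex.continuous_ofReal.comp (continuous_dirichletKer n)
  have hIp : ∀ a b, IntervalIntegrable (fun u => H (x + u)) volume a b := fun a b => by
    have := (hI (x + a) (x + b)).comp_add_left x
    simpa using this
  have hIm : ∀ a b, IntervalIntegrable (fun u => H (x - u)) volume a b := fun a b => by
    have := (hI (x - a) (x - b)).comp_sub_left x
    simpa using this
  set G : ℝ → ℂ := fun u => H (x + u) * (dirichletKer n u : ℂ) with hG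
  have hGper : Function.Periodic G Real.pi := by
    intro u
    simp only [hG]
    rw [periodic_dirichletKer n u, ← add_assoc, hper]
  have hGint : ∀ a b, IntervalIntegrable G volume a b := fun a b =>
    (hIp a b).mul_continuousOn hcont.continuousOn
  rw [expSum_eq_integral hInt]
  congr 1
  calc ∫ t in (0 : ℝ)..Real.pi, H t * (dirichletKer n (t - x) : ℂ)
      = ∫ t in (0 : ℝ)..Real.pi, G (t - x) := by simp [hG]
    _ = ∫ t in (-x)..(-x + Real.pi), G t := by
        rw [intervalIntegral.integral_comp_sub_right]; congr 1 <;> ring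
    _ = ∫ t in (-(Real.pi / 2))..(-(Real.pi / 2) + Real.pi), G t :=
        hGper.intervalIntegral_add_eq _ _
    _ = (∫ t in (-(Real.pi / 2))..0, G t) + ∫ t in (0 : ℝ)..(Real.pi / 2), G t := by
        rw [intervalIntegral.integral_add_adjacent_intervals (hGint _ _) (hGint _ _)]
        congr 1; ring
    _ = (∫ t in (0 : ℝ)..(Real.pi / 2), G (-t)) + ∫ t in (0 : ℝ)..(Real.pi / 2), G t := by
        rw [intervalIntegral.integral_comp_neg]; simp
    _ = _ := by
        rw [add_comm, ← intervalIntegral.integral_add (hGint _ _)]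
        · refine intervalIntegral.integral_congr fun u _ => ?_
          simp only [hG, dirichletKer_neg, ← sub_eq_add_neg]; ring
        · simp only [hG, dirichletKer_neg, ← sub_eq_add_neg]
          exact (hIm _ _).mul_continuousOn hcont.continuousOn

/-- Uniform convergence of the Fourier series of a periodic function with coefficients of order
`1 / |k|`, on any set where the symmetrised function has a uniform limit. -/
theorem tendstoUniformlyOn_expSum {H : ℝ → ℂ} (hper : Function.Periodic H Real.pi)
    (hInt : IntervalIntegrable H volume 0 Real.pi) {B : ℝ} (hB : ∀ t, ‖H t‖ ≤ B) {C : ℝ}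
    (hC : ∀ k : ℤ, k ≠ 0 → ‖expCoeff H k‖ ≤ C / |(k : ℝ)|) {S : Set ℝ} {s : ℝ → ℂ}
    (hlim : ∀ ε > 0, ∃ δ > 0, ∀ x ∈ S, ∀ u ∈ Set.Ioo 0 δ, ‖H (x + u) + H (x - u) - 2 * s x‖ ≤ ε) :
    TendstoUniformlyOn (expSum H) s atTop S := by
  have hπ := Real.pi_pos
  have hI : ∀ a b, IntervalIntegrable H volume a b :=
    hper.intervalIntegrable₀ Real.pi_ne_zero hInt
  obtain ⟨δ₁, hδ₁, hlim₁⟩ := hlim 1 one_pos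
  have hbdd : ∀ x ∈ S, ∀ u, ‖H (x + u) + H (x - u) - 2 * s x‖ ≤ 4 * B + 1 := by
    intro x hx u
    have h1 := hlim₁ x hx (δ₁ / 2) ⟨by linarith, by linarith⟩
    have h2 : H (x + u) + H (x - u) - 2 * s x =
        (H (x + u) + H (x - u)) - (H (x + δ₁ / 2) + H (x - δ₁ / 2)) +
        (H (x + δ₁ / 2) + H (x - δ₁ / 2) - 2 * s x) := by ring
    rw [h2]
    have h3 := norm_add_le (H (x + u)) (H (x - u))
    have h4 := norm_add_le (H (x + δ₁ / 2)) (H (x - δ₁ / 2))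
    refine (norm_add_le _ _).trans ?_
    have h5 := norm_sub_le (H (x + u) + H (x - u)) (H (x + δ₁ / 2) + H (x - δ₁ / 2))
    linarith [hB (x + u), hB (x - u), hB (x + δ₁ / 2), hB (x - δ₁ / 2)]
  refine tendstoUniformlyOn_of_cesaro (C := 2 * C) ?_ ?_
  · intro n x _
    rw [expSum, expSum, sum_Icc_neg_succ, add_sub_cancel_left]
    refine (norm_add_le _ _).trans ?_
    rw [norm_mul, norm_mul, norm_exp_neg_two_I_int_mul, norm_exp_neg_two_I_int_mul, mul_one,
      mul_one]
    have h1 := hC (n + 1) (by omega)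
    have h2 := hC (-(n + 1)) (by omega)
    have h3 : |(n : ℝ) + 1| = n + 1 := abs_of_pos (by positivity)
    push_cast at h1 h2
    rw [abs_neg, h3] at h2
    rw [h3] at h1
    calc _ ≤ C / ((n : ℝ) + 1) + C / (n + 1) := add_le_add h1 h2
      _ = _ := by ring
  · intro ε hε
    obtain ⟨δ₀, hδ₀, hlim₀⟩ := hlim ε hε
    set δ := min δ₀ (Real.pi / 2) with hδdef
    have hδ : 0 < δ := lt_min hδ₀ (by positivity)
    have hsin : ∀ u ∈ Set.Ioc 0 (Real.pi / 2), 0 < Real.sin u := fun u hu =>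
      Real.sin_pos_of_pos_of_lt_pi hu.1 (by linarith [hu.2])
    have hsδ : 0 < Real.sin δ := hsin δ ⟨hδ, min_le_right _ _⟩
    set K := (4 * B + 1) / Real.sin δ ^ 2 with hK
    have hB0 : 0 ≤ B := (norm_nonneg _).trans (hB 0)
    have hK0 : 0 ≤ K := by positivity
    obtain ⟨N₀, hN₀⟩ := exists_nat_gt (K / ε)
    refine ⟨N₀, fun N hN x hx => ?_⟩
    have hrep : ∑ n ∈ Finset.range N, (expSum H n x - s x) = 1 / (Real.pi : ℂ) *
        ∫ u in (0 : ℝ)..(Real.pi / 2),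
          (H (x + u) + H (x - u) - 2 * s x) * (fejerKer N u : ℂ) := by
      have hpos : IntervalIntegrable (fun u => H (x + u) + H (x - u)) volume 0 (Real.pi / 2) := by
        have h1 := (hI (x + 0) (x + Real.pi / 2)).comp_add_left x
        have h2 := (hI (x - 0) (x - Real.pi / 2)).comp_sub_left x
        refine IntervalIntegrable.add ?_ ?_
        · simpa using h1
        · simpa using h2
      have hterm : ∀ n, expSum H n x - s x = 1 / (Real.pi : ℂ) *
          ∫ u in (0 : ℝ)..(Real.pi / 2),
            (H (x + u) + H (x - u) - 2 * s x) * (dirichletKer n u : ℂ) := by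
        intro n
        have hcont : Continuous fun u : ℝ => (dirichletKer n u : ℂ) :=
          Complex.continuous_ofReal.comp (continuous_dirichletKer n)
        simp only [sub_mul (_ + _)]
        rw [intervalIntegral.integral_sub (hpos.mul_continuousOn hcont.continuousOn)
          (Continuous.intervalIntegrable (by fun_prop) _ _), intervalIntegral.integral_const_mul,
          intervalIntegral.integral_ofReal, integral_dirichletKer, mul_sub,
          ← expSum_eq_half_integral hper hInt]
        have : (Real.pi : ℂ) ≠ 0 := by exact_mod_cast Real.pi_ne_zero
        push_cast
        field_simp
      rw [Finset.sum_congr rfl fun n _ => hterm n, ← Finset.mul_sum,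
        ← intervalIntegral.integral_finsetSum]
      · simp only [fejerKer, Complex.ofReal_sum, Finset.mul_sum]
      · intro n _
        exact (hpos.sub (by simp)).mul_continuousOn
          (Complex.continuous_ofReal.comp (continuous_dirichletKer n)).continuousOn
    rw [hrep, norm_mul, norm_div, norm_one, Complex.norm_real, Real.norm_of_nonneg hπ.le]
    have hbound : ‖∫ u in (0 : ℝ)..(Real.pi / 2),
        (H (x + u) + H (x - u) - 2 * s x) * (fejerKer N u : ℂ)‖ ≤
        ∫ u in (0 : ℝ)..(Real.pi / 2), (ε * fejerKer N u + K) := by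
      refine intervalIntegral.norm_integral_le_of_norm_le (by positivity)
        (Eventually.of_forall fun u hu => ?_)
        ((((continuous_fejerKer N).const_mul ε).add continuous_const).intervalIntegrable _ _)
      have hu0 := hsin u hu
      have hF := fejerKer_nonneg (N := N) hu0
      rw [norm_mul, Complex.norm_real, Real.norm_of_nonneg hF]
      rcases lt_or_ge u δ with hlt | hge
      · have := hlim₀ x hx u ⟨hu.1, hlt.trans_le (min_le_left _ _)⟩
        nlinarith
      · have h1 : Real.sin δ ≤ Real.sin u :=
          Real.sin_le_sin_of_le_of_le_pi_div_two (by linarith) hu.2 hge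
        have h2 : fejerKer N u ≤ 1 / Real.sin δ ^ 2 := (fejerKer_le hu0).trans (by gcongr)
        calc _ ≤ (4 * B + 1) * (1 / Real.sin δ ^ 2) := by
              gcongr; exact hbdd x hx u
          _ = K := by rw [hK]; ring
          _ ≤ _ := by nlinarith
    have hcalc : ∫ u in (0 : ℝ)..(Real.pi / 2), (ε * fejerKer N u + K) =
        (ε * N + K) * (Real.pi / 2) := by
      rw [intervalIntegral.integral_add
        (((continuous_fejerKer N).const_mul ε).intervalIntegrable _ _) (by simp),
        intervalIntegral.integral_const_mul, integral_fejerKer]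
      simp; ring
    rw [hcalc] at hbound
    have hKN : K ≤ ε * N := by
      rw [div_lt_iff₀ hε] at hN₀
      have : (N₀ : ℝ) ≤ N := by exact_mod_cast hN
      nlinarith
    calc _ ≤ 1 / Real.pi * ((ε * N + K) * (Real.pi / 2)) := by gcongr
      _ = (ε * N + K) / 2 := by field_simp
      _ ≤ ε * N := by linarith

/-- The `π`-periodic function agreeing with `h` on `[0, π)`. -/
noncomputable def periodicExt (h : ℝ → ℂ) (t : ℝ) : ℂ := h (toIcoMod Real.pi_pos 0 t)

theorem periodicExt_periodic (h : ℝ → ℂ) : Function.Periodic (periodicExt h) Real.pi := fun t => by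
  simp only [periodicExt, toIcoMod_add_right]

theorem periodicExt_of_mem {h : ℝ → ℂ} {t : ℝ} (ht : t ∈ Set.Ico 0 Real.pi) :
    periodicExt h t = h t := by
  rw [periodicExt, (toIcoMod_eq_self Real.pi_pos).2 (by simpa using ht)]

theorem periodicExt_neg {h : ℝ → ℂ} {u : ℝ} (hu : u ∈ Set.Ioo 0 Real.pi) :
    periodicExt h (-u) = h (Real.pi - u) := by
  rw [← periodicExt_periodic h (-u), neg_add_eq_sub,
    periodicExt_of_mem ⟨by linarith [hu.2], by linarith [hu.1]⟩]

theorem periodicExt_eqOn (h : ℝ → ℂ) : Set.EqOn (periodicExt h) h (Set.Ioo 0 Real.pi) :=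
  fun _ ht => periodicExt_of_mem (Set.Ioo_subset_Ico_self ht)

theorem expCoeff_periodicExt (h : ℝ → ℂ) : expCoeff (periodicExt h) = expCoeff h := by
  ext k
  rw [expCoeff, expCoeff, intervalIntegral.integral_of_le Real.pi_pos.le,
    intervalIntegral.integral_of_le Real.pi_pos.le, integral_Ioc_eq_integral_Ioo,
    integral_Ioc_eq_integral_Ioo]
  congr 1
  refine setIntegral_congr_fun measurableSet_Ioo fun t ht => ?_
  simp only [periodicExt_eqOn h ht]

theorem expSum_periodicExt (h : ℝ → ℂ) : expSum (periodicExt h) = expSum h := by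
  unfold expSum; rw [expCoeff_periodicExt]

theorem intervalIntegrable_periodicExt {h : ℝ → ℂ} (hh : IntervalIntegrable h volume 0 Real.pi) :
    IntervalIntegrable (periodicExt h) volume 0 Real.pi := by
  rw [intervalIntegrable_iff_integrableOn_Ioo_of_le Real.pi_pos.le] at hh ⊢
  exact hh.congr_fun (periodicExt_eqOn h).symm measurableSet_Ioo

theorem continuous_periodicExt {h : ℝ → ℂ} (hc : ContinuousOn h (Set.Icc 0 Real.pi))
    (hend : h 0 = h Real.pi) : Continuous (periodicExt h) := by
  have : Fact (0 < Real.pi) := ⟨Real.pi_pos⟩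
  exact (AddCircle.liftIco_zero_continuous hend hc).comp (AddCircle.continuous_mk' Real.pi)

theorem BoundedVariationOn.tendstoUniformlyOn_expSum {h : ℝ → ℂ}
    (hh : BoundedVariationOn h (Set.Icc 0 Real.pi)) {S : Set ℝ} {s : ℝ → ℂ}
    (hlim : ∀ ε > 0, ∃ δ > 0, ∀ x ∈ S, ∀ u ∈ Set.Ioo 0 δ,
      ‖periodicExt h (x + u) + periodicExt h (x - u) - 2 * s x‖ ≤ ε) :
    TendstoUniformlyOn (expSum h) s atTop S := by
  rw [← expSum_periodicExt]
  refine _root_.tendstoUniformlyOn_expSum (periodicExt_periodic h)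
    (intervalIntegrable_periodicExt (hh.intervalIntegrable_complex Real.pi_pos.le))
    (B := ‖h 0‖ + (eVariationOn h (Set.Icc 0 Real.pi)).toReal) (fun t => ?_)
    (fun k hk => (expCoeff_periodicExt h).symm ▸ hh.norm_expCoeff_le hk) hlim
  have ht : toIcoMod Real.pi_pos 0 t ∈ Set.Icc 0 Real.pi :=
    Set.Ico_subset_Icc_self (toIcoMod_mem_Ico' Real.pi_pos t)
  have h1 := hh.dist_le ht (Set.left_mem_Icc.2 Real.pi_pos.le)
  rw [dist_eq_norm] at h1
  have h2 := norm_add_le (h 0) (h (toIcoMod Real.pi_pos 0 t) - h 0)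
  rw [add_sub_cancel] at h2
  exact h2.trans (by linarith)

theorem BoundedVariationOn.tendsto_expSum {h : ℝ → ℂ}
    (hh : BoundedVariationOn h (Set.Icc 0 Real.pi)) {x : ℝ} {l r : ℂ}
    (hr : Tendsto (fun u => periodicExt h (x + u)) (𝓝[>] 0) (𝓝 r))
    (hl : Tendsto (fun u => periodicExt h (x - u)) (𝓝[>] 0) (𝓝 l)) :
    Tendsto (fun n => expSum h n x) atTop (𝓝 ((l + r) / 2)) := by
  rw [← tendstoUniformlyOn_singleton_iff_tendsto (F := expSum h) (f := fun _ => (l + r) / 2)]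
  refine hh.tendstoUniformlyOn_expSum fun ε hε => ?_
  have h1 := Metric.tendsto_nhds.1 (hr.add hl) ε hε
  obtain ⟨δ, hδ, hsub⟩ := mem_nhdsGT_iff_exists_Ioo_subset.1 h1
  refine ⟨δ, hδ, fun y hy u hu => ?_⟩
  rw [Set.mem_singleton_iff.1 hy]
  have : dist _ _ < ε := hsub hu
  rw [dist_eq_norm] at this
  refine le_of_eq_of_le ?_ this.le
  congr 1; ring

/-- Dirichlet–Jordan at an interior point. -/
theorem BoundedVariationOn.tendsto_expSum_of_mem_Ioo {h : ℝ → ℂ}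
    (hh : BoundedVariationOn h (Set.Icc 0 Real.pi)) {x : ℝ} (hx : x ∈ Set.Ioo 0 Real.pi) {l r : ℂ}
    (hl : Tendsto h (𝓝[Set.Ioo 0 x] x) (𝓝 l)) (hr : Tendsto h (𝓝[Set.Ioo x Real.pi] x) (𝓝 r)) :
    Tendsto (fun n => expSum h n x) atTop (𝓝 ((l + r) / 2)) := by
  refine hh.tendsto_expSum ?_ ?_
  · have hev : ∀ᶠ u in 𝓝[>] (0 : ℝ), u ∈ Set.Ioo 0 (Real.pi - x) :=
      Ioo_mem_nhdsGT (by linarith [hx.2])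
    have ht : Tendsto (fun u : ℝ => x + u) (𝓝[>] 0) (𝓝[Set.Ioo x Real.pi] x) :=
      tendsto_nhdsWithin_iff.2 ⟨Tendsto.mono_left (Continuous.tendsto' (by fun_prop) _ _ (by simp))
        nhdsWithin_le_nhds, hev.mono fun u hu => ⟨by linarith [hu.1], by linarith [hu.2]⟩⟩
    refine (hr.comp ht).congr' (hev.mono fun u hu => ?_)
    have hmem : x + u ∈ Set.Ico 0 Real.pi := ⟨by linarith [hu.1, hx.1], by linarith [hu.2]⟩
    exact (periodicExt_of_mem hmem).symm
  · have hev : ∀ᶠ u in 𝓝[>] (0 : ℝ), u ∈ Set.Ioo 0 x := Ioo_mem_nhdsGT hx.1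
    have ht : Tendsto (fun u : ℝ => x - u) (𝓝[>] 0) (𝓝[Set.Ioo 0 x] x) :=
      tendsto_nhdsWithin_iff.2 ⟨Tendsto.mono_left (Continuous.tendsto' (by fun_prop) _ _ (by simp))
        nhdsWithin_le_nhds, hev.mono fun u hu => ⟨by linarith [hu.2], by linarith [hu.1]⟩⟩
    refine (hl.comp ht).congr' (hev.mono fun u hu => ?_)
    have hmem : x - u ∈ Set.Ico 0 Real.pi := ⟨by linarith [hu.2], by linarith [hu.1, hx.2]⟩
    exact (periodicExt_of_mem hmem).symm

/-- Dirichlet–Jordan at the left end of the period. -/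
theorem BoundedVariationOn.tendsto_expSum_zero {h : ℝ → ℂ}
    (hh : BoundedVariationOn h (Set.Icc 0 Real.pi))
    (h0 : ContinuousWithinAt h (Set.Icc 0 Real.pi) 0)
    (hπ : ContinuousWithinAt h (Set.Icc 0 Real.pi) Real.pi) :
    Tendsto (fun n => expSum h n 0) atTop (𝓝 ((h Real.pi + h 0) / 2)) := by
  have hev : ∀ᶠ u in 𝓝[>] (0 : ℝ), u ∈ Set.Ioo 0 Real.pi := Ioo_mem_nhdsGT Real.pi_pos
  refine hh.tendsto_expSum ?_ ?_
  · have ht : Tendsto (fun u : ℝ => u) (𝓝[>] 0) (𝓝[Set.Icc 0 Real.pi] 0) :=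
      tendsto_nhdsWithin_iff.2 ⟨nhdsWithin_le_nhds, hev.mono fun u hu => Set.Ioo_subset_Icc_self hu⟩
    refine (h0.tendsto.comp ht).congr' (hev.mono fun u hu => ?_)
    simp [periodicExt_eqOn h hu]
  · have ht : Tendsto (fun u : ℝ => Real.pi - u) (𝓝[>] 0) (𝓝[Set.Icc 0 Real.pi] Real.pi) :=
      tendsto_nhdsWithin_iff.2 ⟨Tendsto.mono_left (Continuous.tendsto' (by fun_prop) _ _ (by simp))
        nhdsWithin_le_nhds, hev.mono fun u hu => ⟨by linarith [hu.2], by linarith [hu.1]⟩⟩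
    refine (hπ.tendsto.comp ht).congr' (hev.mono fun u hu => ?_)
    simp [periodicExt_neg hu]

theorem expSum_pi (h : ℝ → ℂ) (n : ℕ) : expSum h n Real.pi = expSum h n 0 := by
  unfold expSum
  refine Finset.sum_congr rfl fun k _ => ?_
  congr 1
  rw [Complex.exp_eq_exp_iff_exists_int]
  exact ⟨-k, by push_cast; ring⟩

/-- The Fourier series of a continuous function of bounded variation with equal end values
converges uniformly. -/
theorem BoundedVariationOn.tendstoUniformlyOn_expSum_of_continuousOn {h : ℝ → ℂ}
    (hh : BoundedVariationOn h (Set.Icc 0 Real.pi)) (hc : ContinuousOn h (Set.Icc 0 Real.pi))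
    (hend : h 0 = h Real.pi) :
    TendstoUniformlyOn (expSum h) h atTop (Set.Icc 0 Real.pi) := by
  have hcont := continuous_periodicExt hc hend
  have hval : ∀ x ∈ Set.Icc 0 Real.pi, periodicExt h x = h x := by
    intro x hx
    rcases hx.2.lt_or_eq with hlt | rfl
    · exact periodicExt_of_mem ⟨hx.1, hlt⟩
    · have h0 := periodicExt_periodic h 0
      rw [zero_add] at h0
      rw [h0, periodicExt_of_mem ⟨le_rfl, Real.pi_pos⟩, hend]
  refine hh.tendstoUniformlyOn_expSum fun ε hε => ?_
  have hunif := (isCompact_Icc (a := -Real.pi) (b := 2 * Real.pi)).uniformContinuousOn_of_continuous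
    hcont.continuousOn
  obtain ⟨δ, hδ, hclose⟩ := Metric.uniformContinuousOn_iff.1 hunif (ε / 2) (by positivity)
  refine ⟨min δ Real.pi, lt_min hδ Real.pi_pos, fun x hx u hu => ?_⟩
  have hu1 : u < δ := hu.2.trans_le (min_le_left _ _)
  have hu2 : u < Real.pi := hu.2.trans_le (min_le_right _ _)
  have hu0 : |u| < δ := by rwa [abs_of_pos hu.1]
  have hx' : x ∈ Set.Icc (-Real.pi) (2 * Real.pi) :=
    ⟨by linarith [hx.1, Real.pi_pos], by linarith [hx.2, Real.pi_pos]⟩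
  have h1 := hclose (x + u) ⟨by linarith [hx'.1, hu.1], by linarith [hx.2]⟩ x hx'
    (by simpa [Real.dist_eq] using hu0)
  have h2 := hclose (x - u) ⟨by linarith [hx.1], by linarith [hx'.2, hu.1]⟩ x hx'
    (by simpa [Real.dist_eq] using hu0)
  rw [dist_eq_norm] at h1 h2
  rw [← hval x hx]
  have h3 : periodicExt h (x + u) + periodicExt h (x - u) - 2 * periodicExt h x =
      (periodicExt h (x + u) - periodicExt h x) + (periodicExt h (x - u) - periodicExt h x) := by
    ring
  rw [h3]
  exact (norm_add_le _ _).trans (by linarith)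

/-- The scalar function whose Fourier series on `[0, π]` carries one of the two branches of the
spectral decomposition. -/
noncomputable def branchFun (p q τ : ℂ) (f g : ℝ → ℂ) (t : ℝ) : ℂ :=
  Complex.exp (-(Complex.I * τ * ((Real.pi : ℂ) - t))) * (p * f t + q * g (Real.pi - t))

theorem boundedVariationOn_comp_pi_sub {g : ℝ → ℂ}
    (hg : BoundedVariationOn g (Set.Icc 0 Real.pi)) :
    BoundedVariationOn (fun t => g (Real.pi - t)) (Set.Icc 0 Real.pi) :=
  ne_top_of_le_ne_top hg (eVariationOn.comp_le_of_antitoneOn g (fun t => Real.pi - t)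
    (fun x _ y _ hxy => by simp only; linarith)
    (fun x hx => ⟨by linarith [hx.2], by linarith [hx.1]⟩))

theorem ContDiff.boundedVariationOn_Icc {e : ℝ → ℂ} (he : ContDiff ℝ 1 e) {a b : ℝ} :
    BoundedVariationOn e (Set.Icc a b) := by
  obtain ⟨K, hK⟩ := (he.locallyLipschitz.locallyLipschitzOn
    (s := Set.Icc a b)).exists_lipschitzOnWith_of_compact isCompact_Icc
  exact hK.comp_boundedVariationOn (fun x hx => hx) (BoundedVariationOn.id_Icc a b)

theorem boundedVariationOn_branchFun {p q τ : ℂ} {f g : ℝ → ℂ}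
    (hf : BoundedVariationOn f (Set.Icc 0 Real.pi))
    (hg : BoundedVariationOn g (Set.Icc 0 Real.pi)) :
    BoundedVariationOn (branchFun p q τ f g) (Set.Icc 0 Real.pi) := by
  have hconst : ∀ c : ℂ, BoundedVariationOn (fun _ : ℝ => c) (Set.Icc 0 Real.pi) := fun c =>
    contDiff_const.boundedVariationOn_Icc
  have hexp : BoundedVariationOn
      (fun t : ℝ => Complex.exp (-(Complex.I * τ * ((Real.pi : ℂ) - t)))) (Set.Icc 0 Real.pi) :=
    ContDiff.boundedVariationOn_Icc
      (ContDiff.cexp (contDiff_const.mul (contDiff_const.sub Complex.ofRealCLM.contDiff)).neg)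
  exact hexp.fun_smul (((hconst p).fun_smul hf).add_complex
    ((hconst q).fun_smul (boundedVariationOn_comp_pi_sub hg)))

theorem tendsto_branchFun {p q τ : ℂ} {f g : ℝ → ℂ} {l : Filter ℝ} {x : ℝ} {u v : ℂ}
    (hl : l ≤ 𝓝 x) (hf : Tendsto f l (𝓝 u)) (hg : Tendsto (fun t => g (Real.pi - t)) l (𝓝 v)) :
    Tendsto (branchFun p q τ f g) l
      (𝓝 (Complex.exp (-(Complex.I * τ * ((Real.pi : ℂ) - x))) * (p * u + q * v))) := by
  refine Tendsto.mul (Tendsto.mono_left (Continuous.tendsto ?_ x) hl)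
    ((hf.const_mul p).add (hg.const_mul q))
  fun_prop

theorem continuousWithinAt_comp_pi_sub {g : ℝ → ℂ} {x : ℝ}
    (hg : ContinuousWithinAt g (Set.Icc 0 Real.pi) (Real.pi - x)) :
    ContinuousWithinAt (fun t => g (Real.pi - t)) (Set.Icc 0 Real.pi) x :=
  ContinuousWithinAt.comp (f := fun t : ℝ => Real.pi - t) hg (by fun_prop)
    (fun t ht => ⟨by linarith [ht.2], by linarith [ht.1]⟩)

theorem continuousWithinAt_branchFun {p q τ : ℂ} {f g : ℝ → ℂ} {x : ℝ}
    (hf : ContinuousWithinAt f (Set.Icc 0 Real.pi) x)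
    (hg : ContinuousWithinAt g (Set.Icc 0 Real.pi) (Real.pi - x)) :
    ContinuousWithinAt (branchFun p q τ f g) (Set.Icc 0 Real.pi) x :=
  tendsto_branchFun nhdsWithin_le_nhds hf (continuousWithinAt_comp_pi_sub hg)

/-- The coefficients of the spectral decomposition are Fourier coefficients. -/
theorem pairing_eq_expCoeff {p q τ : ℂ} {f g : ℝ → ℂ}
    (hf : IntervalIntegrable f volume 0 Real.pi) (hg : IntervalIntegrable g volume 0 Real.pi)
    (k : ℤ) :
    1 / (Real.pi : ℂ) * ∫ x in (0 : ℝ)..Real.pi,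
      (f x * (starRingEnd ℂ) ((starRingEnd ℂ) p *
          Complex.exp (Complex.I * (starRingEnd ℂ) τ * ((Real.pi : ℂ) - x)) *
          Complex.exp (-Complex.I * ((2 * k : ℤ) : ℂ) * x)) +
        g x * (starRingEnd ℂ) ((starRingEnd ℂ) q *
          Complex.exp (Complex.I * (starRingEnd ℂ) τ * x) *
          Complex.exp (Complex.I * ((2 * k : ℤ) : ℂ) * x))) =
      expCoeff (branchFun p q τ f g) k := by
  set F : ℝ → ℂ := fun x => f x * (p * Complex.exp (-(Complex.I * τ * ((Real.pi : ℂ) - x))) *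
    Complex.exp (2 * Complex.I * k * x)) with hF
  set G : ℝ → ℂ := fun x => g x * (q * Complex.exp (-(Complex.I * τ * x)) *
    Complex.exp (-(2 * Complex.I * k * x))) with hG
  have hFi : IntervalIntegrable F volume 0 Real.pi := hf.mul_continuousOn (by fun_prop)
  have hGi : IntervalIntegrable G volume 0 Real.pi := hg.mul_continuousOn (by fun_prop)
  have hGi' : IntervalIntegrable (fun x => G (Real.pi - x)) volume 0 Real.pi := by
    have := hGi.comp_sub_left Real.pi
    simpa using this.symm
  have hGr : ∫ x in (0 : ℝ)..Real.pi, G (Real.pi - x) = ∫ x in (0 : ℝ)..Real.pi, G x := by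
    rw [intervalIntegral.integral_comp_sub_left]; simp
  rw [expCoeff]
  congr 1
  calc _ = ∫ x in (0 : ℝ)..Real.pi, (F x + G x) := by
        refine intervalIntegral.integral_congr fun x _ => ?_
        simp only [hF, hG, map_mul, Complex.conj_conj, ← Complex.exp_conj, Complex.conj_I,
          map_sub, map_neg, Complex.conj_ofReal, map_intCast]
        congr 3
        · congr 2; ring
        · congr 1; push_cast; ring
        · congr 2; ring
        · congr 1; push_cast; ring
    _ = ∫ x in (0 : ℝ)..Real.pi, (F x + G (Real.pi - x)) := by
        rw [intervalIntegral.integral_add hFi hGi, intervalIntegral.integral_add hFi hGi', hGr]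
    _ = _ := by
        refine intervalIntegral.integral_congr fun x _ => ?_
        have he : Complex.exp (-(2 * Complex.I * k * ((Real.pi - x : ℝ) : ℂ))) =
            Complex.exp (2 * Complex.I * k * x) := by
          rw [Complex.exp_eq_exp_iff_exists_int]
          exact ⟨-k, by push_cast; ring⟩
        simp only [hF, hG, branchFun, he]
        push_cast
        ring

theorem sum_even_Icc {M : Type*} [AddCommMonoid M] (F : ℤ → M) (N : ℕ) :
    ∑ m ∈ Finset.Icc (-(N : ℤ)) N, (if Even m then F m else 0) =
      ∑ k ∈ Finset.Icc (-((N / 2 : ℕ) : ℤ)) ((N / 2 : ℕ) : ℤ), F (2 * k) := by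
  rw [← Finset.sum_filter]
  symm
  refine Finset.sum_bij (fun k _ => 2 * k) ?_ ?_ ?_ ?_
  · intro k hk
    simp only [Finset.mem_filter, Finset.mem_Icc] at hk ⊢
    exact ⟨by omega, even_two_mul k⟩
  · intro a _ b _ h; omega
  · intro m hm
    simp only [Finset.mem_filter, Finset.mem_Icc] at hm
    obtain ⟨⟨h1, h2⟩, r, rfl⟩ := hm
    exact ⟨r, by simp only [Finset.mem_Icc]; omega, by ring⟩
  · intro k _; rfl

theorem sum_expCoeff_mul_exp_pi_sub (h : ℝ → ℂ) (n : ℕ) (x : ℝ) :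
    ∑ k ∈ Finset.Icc (-(n : ℤ)) n, expCoeff h k * Complex.exp (2 * Complex.I * k * x) =
      expSum h n (Real.pi - x) := by
  refine Finset.sum_congr rfl fun k _ => ?_
  congr 1
  rw [Complex.exp_eq_exp_iff_exists_int]
  exact ⟨k, by push_cast; ring⟩

/-- The partial sums of the spectral decomposition in terms of scalar Fourier partial sums. -/
theorem SMsum_eq (α₁ α₂ β₁ β₂ α₁' α₂' β₁' β₂' τ₁ τ₂ : ℂ) {f g : ℝ → ℂ}
    (hf : IntervalIntegrable f volume 0 Real.pi) (hg : IntervalIntegrable g volume 0 Real.pi)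
    (M : ℕ) (x : ℝ) :
    SMsum α₁ α₂ β₁ β₂ α₁' α₂' β₁' β₂' τ₁ τ₂ f g M x =
      (α₁ * Complex.exp (Complex.I * τ₁ * ((Real.pi : ℂ) - x)) *
          expSum (branchFun α₁' α₂' τ₁ f g) (M / 2) x +
        β₁ * Complex.exp (Complex.I * τ₂ * ((Real.pi : ℂ) - x)) *
          expSum (branchFun β₁' β₂' τ₂ f g) (M / 2) x,
       α₂ * Complex.exp (Complex.I * τ₁ * x) *
          expSum (branchFun α₁' α₂' τ₁ f g) (M / 2) (Real.pi - x) +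
        β₂ * Complex.exp (Complex.I * τ₂ * x) *
          expSum (branchFun β₁' β₂' τ₂ f g) (M / 2) (Real.pi - x)) := by
  have h0 : ∀ k : ℤ, pairSR f g (phitSR α₁' α₂' β₁' β₂' τ₁ τ₂ 0 (2 * k)) =
      expCoeff (branchFun α₁' α₂' τ₁ f g) k := fun k => by
    rw [← pairing_eq_expCoeff hf hg]; simp [pairSR, phitSR]
  have h1 : ∀ k : ℤ, pairSR f g (phitSR α₁' α₂' β₁' β₂' τ₁ τ₂ 1 (2 * k)) =
      expCoeff (branchFun β₁' β₂' τ₂ f g) k := fun k => by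
    rw [← pairing_eq_expCoeff hf hg]; simp [pairSR, phitSR]
  have hm : ∀ k : ℤ, Complex.exp (-Complex.I * ((2 * k : ℤ) : ℂ) * x) =
      Complex.exp (-(2 * Complex.I * k * x)) := fun k => by congr 1; push_cast; ring
  have hp : ∀ k : ℤ, Complex.exp (Complex.I * ((2 * k : ℤ) : ℂ) * x) =
      Complex.exp (2 * Complex.I * k * x) := fun k => by congr 1; push_cast; ring
  rw [SMsum, sum_even_Icc]
  simp only [h0, h1]
  ext
  · simp only [Prod.fst_sum, Prod.fst_add, Prod.smul_fst, phiSR, if_true, one_ne_zero, if_false,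
      smul_eq_mul, hm, expSum, Finset.mul_sum, ← Finset.sum_add_distrib]
    refine Finset.sum_congr rfl fun k _ => ?_
    ring
  · rw [← sum_expCoeff_mul_exp_pi_sub, ← sum_expCoeff_mul_exp_pi_sub]
    simp only [Prod.snd_sum, Prod.snd_add, Prod.smul_snd, phiSR, if_true, one_ne_zero, if_false,
      smul_eq_mul, hp, Finset.mul_sum, ← Finset.sum_add_distrib]
    refine Finset.sum_congr rfl fun k _ => ?_
    ring

theorem TendstoUniformlyOn.bounded_mul {X : Type*} {S : Set X} {F : ℕ → X → ℂ} {φ c : X → ℂ}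
    {K : ℝ} (hc : ∀ x ∈ S, ‖c x‖ ≤ K) (h : TendstoUniformlyOn F φ atTop S) :
    TendstoUniformlyOn (fun n x => c x * F n x) (fun x => c x * φ x) atTop S := by
  rw [Metric.tendstoUniformlyOn_iff] at h ⊢
  intro ε hε
  have hK : 0 < |K| + 1 := by positivity
  filter_upwards [h (ε / (|K| + 1)) (by positivity)] with n hn x hx
  have h1 := hn x hx
  rw [dist_eq_norm] at h1 ⊢
  rw [← mul_sub, norm_mul]
  rw [lt_div_iff₀ hK] at h1
  have h2 : ‖c x‖ ≤ |K| + 1 := (hc x hx).trans ((le_abs_self K).trans (by linarith))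
  nlinarith [norm_nonneg (φ x - F n x)]

theorem tendsto_SMsum {α₁ α₂ β₁ β₂ α₁' α₂' β₁' β₂' τ₁ τ₂ : ℂ} {f g : ℝ → ℂ}
    (hf : IntervalIntegrable f volume 0 Real.pi) (hg : IntervalIntegrable g volume 0 Real.pi)
    {x : ℝ} {A₁ A₂ B₁ B₂ : ℂ}
    (hA₁ : Tendsto (fun n => expSum (branchFun α₁' α₂' τ₁ f g) n x) atTop (𝓝 A₁))
    (hA₂ : Tendsto (fun n => expSum (branchFun β₁' β₂' τ₂ f g) n x) atTop (𝓝 A₂))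
    (hB₁ : Tendsto (fun n => expSum (branchFun α₁' α₂' τ₁ f g) n (Real.pi - x)) atTop (𝓝 B₁))
    (hB₂ : Tendsto (fun n => expSum (branchFun β₁' β₂' τ₂ f g) n (Real.pi - x)) atTop (𝓝 B₂)) :
    Tendsto (fun M : ℕ => SMsum α₁ α₂ β₁ β₂ α₁' α₂' β₁' β₂' τ₁ τ₂ f g M x) atTop
      (𝓝 (α₁ * Complex.exp (Complex.I * τ₁ * ((Real.pi : ℂ) - x)) * A₁ +
          β₁ * Complex.exp (Complex.I * τ₂ * ((Real.pi : ℂ) - x)) * A₂,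
        α₂ * Complex.exp (Complex.I * τ₁ * x) * B₁ +
          β₂ * Complex.exp (Complex.I * τ₂ * x) * B₂)) := by
  simp only [SMsum_eq _ _ _ _ _ _ _ _ _ _ hf hg]
  have hM := Nat.tendsto_div_const_atTop (n := 2) two_ne_zero
  exact Tendsto.prodMk_nhds
    (((hA₁.comp hM).const_mul _).add ((hA₂.comp hM).const_mul _))
    (((hB₁.comp hM).const_mul _).add ((hB₂.comp hM).const_mul _))

theorem tendsto_comp_pi_sub {g : ℝ → ℂ} {s t : Set ℝ} {x : ℝ} {v : ℂ}
    (hst : ∀ y ∈ s, Real.pi - y ∈ t) (hg : Tendsto g (𝓝[t] (Real.pi - x)) (𝓝 v)) :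
    Tendsto (fun y => g (Real.pi - y)) (𝓝[s] x) (𝓝 v) := by
  refine hg.comp (tendsto_nhdsWithin_iff.2 ⟨?_, ?_⟩)
  · exact ((continuous_const.sub continuous_id).tendsto x).mono_left nhdsWithin_le_nhds
  · filter_upwards [self_mem_nhdsWithin] with y hy using hst y hy

theorem BoundedVariationOn.exists_tendsto_Ioo {f : ℝ → ℂ}
    (hf : BoundedVariationOn f (Set.Icc 0 Real.pi)) {x : ℝ} (hx : x ∈ Set.Ioo 0 Real.pi) :
    ∃ fl fr : ℂ, Tendsto f (𝓝[Set.Ioo 0 x] x) (𝓝 fl) ∧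
      Tendsto f (𝓝[Set.Ioo x Real.pi] x) (𝓝 fr) := by
  obtain ⟨l, hl⟩ := hf.exists_tendsto_left x
  obtain ⟨r, hr⟩ := hf.exists_tendsto_right x
  refine ⟨l, r, hl.mono_left (nhdsWithin_mono _ fun y hy => ?_),
    hr.mono_left (nhdsWithin_mono _ fun y hy => ?_)⟩
  · exact ⟨⟨hy.1.le, (hy.2.trans hx.2).le⟩, hy.2⟩
  · exact ⟨⟨(hx.1.trans hy.1).le, hy.2.le⟩, hy.1⟩

theorem tendsto_expSum_branchFun_of_mem_Ioo {p q τ : ℂ} {f g : ℝ → ℂ}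
    (hf : BoundedVariationOn f (Set.Icc 0 Real.pi))
    (hg : BoundedVariationOn g (Set.Icc 0 Real.pi)) {x : ℝ} (hx : x ∈ Set.Ioo 0 Real.pi)
    {fl fr gl gr : ℂ} (hfl : Tendsto f (𝓝[Set.Ioo 0 x] x) (𝓝 fl))
    (hfr : Tendsto f (𝓝[Set.Ioo x Real.pi] x) (𝓝 fr))
    (hgl : Tendsto g (𝓝[Set.Ioo 0 (Real.pi - x)] (Real.pi - x)) (𝓝 gl))
    (hgr : Tendsto g (𝓝[Set.Ioo (Real.pi - x) Real.pi] (Real.pi - x)) (𝓝 gr)) :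
    Tendsto (fun n => expSum (branchFun p q τ f g) n x) atTop
      (𝓝 (Complex.exp (-(Complex.I * τ * ((Real.pi : ℂ) - x))) *
        (p * ((fl + fr) / 2) + q * ((gl + gr) / 2)))) := by
  have hL : ∀ y ∈ Set.Ioo 0 x, Real.pi - y ∈ Set.Ioo (Real.pi - x) Real.pi := fun y hy =>
    ⟨by linarith [hy.2], by linarith [hy.1]⟩
  have hR : ∀ y ∈ Set.Ioo x Real.pi, Real.pi - y ∈ Set.Ioo 0 (Real.pi - x) := fun y hy =>
    ⟨by linarith [hy.2], by linarith [hy.1]⟩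
  have h := (boundedVariationOn_branchFun (p := p) (q := q) (τ := τ) hf hg).tendsto_expSum_of_mem_Ioo
    hx (tendsto_branchFun nhdsWithin_le_nhds hfl (tendsto_comp_pi_sub hL hgr))
    (tendsto_branchFun nhdsWithin_le_nhds hfr (tendsto_comp_pi_sub hR hgl))
  convert h using 2
  ring

theorem tendsto_expSum_branchFun_zero {p q τ : ℂ} {f g : ℝ → ℂ}
    (hf : BoundedVariationOn f (Set.Icc 0 Real.pi))
    (hg : BoundedVariationOn g (Set.Icc 0 Real.pi))
    (hf0 : ContinuousWithinAt f (Set.Icc 0 Real.pi) 0)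
    (hfπ : ContinuousWithinAt f (Set.Icc 0 Real.pi) Real.pi)
    (hg0 : ContinuousWithinAt g (Set.Icc 0 Real.pi) 0)
    (hgπ : ContinuousWithinAt g (Set.Icc 0 Real.pi) Real.pi) :
    Tendsto (fun n => expSum (branchFun p q τ f g) n 0) atTop
      (𝓝 ((p * f Real.pi + q * g 0 + (Complex.exp (Complex.I * Real.pi * τ))⁻¹ *
        (p * f 0 + q * g Real.pi)) / 2)) := by
  have h := (boundedVariationOn_branchFun (p := p) (q := q) (τ := τ) hf hg).tendsto_expSum_zero
    (continuousWithinAt_branchFun hf0 (by simpa using hgπ))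
    (continuousWithinAt_branchFun hfπ (by simpa using hg0))
  convert h using 3
  simp [branchFun, ← Complex.exp_neg, mul_right_comm]

/-- Uniform convergence for a single spectral branch whose boundary values match up. -/
theorem tendstoUniformlyOn_expSum_branchFun {p q τ : ℂ} {f g : ℝ → ℂ}
    (hf : BoundedVariationOn f (Set.Icc 0 Real.pi))
    (hg : BoundedVariationOn g (Set.Icc 0 Real.pi))
    (hfc : ContinuousOn f (Set.Icc 0 Real.pi)) (hgc : ContinuousOn g (Set.Icc 0 Real.pi))
    (hend : p * f 0 + q * g Real.pi =
      Complex.exp (Complex.I * Real.pi * τ) * (p * f Real.pi + q * g 0)) :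
    TendstoUniformlyOn (expSum (branchFun p q τ f g)) (branchFun p q τ f g) atTop
      (Set.Icc 0 Real.pi) := by
  refine (boundedVariationOn_branchFun hf hg).tendstoUniformlyOn_expSum_of_continuousOn
    (fun x hx => continuousWithinAt_branchFun (hfc x hx)
      (hgc _ ⟨by linarith [hx.2], by linarith [hx.1]⟩)) ?_
  have h : Complex.I * τ * Real.pi = Complex.I * Real.pi * τ := mul_right_comm _ _ _
  simp only [branchFun, Complex.ofReal_zero, sub_zero, sub_self, mul_zero, neg_zero,
    Complex.exp_zero, one_mul, h, hend]
  rw [← mul_assoc, ← Complex.exp_add, neg_add_cancel, Complex.exp_zero, one_mul]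

theorem TendstoUniformlyOn.comp_pi_sub {F : ℕ → ℝ → ℂ} {φ : ℝ → ℂ}
    (h : TendstoUniformlyOn F φ atTop (Set.Icc 0 Real.pi)) :
    TendstoUniformlyOn (fun n x => F n (Real.pi - x)) (fun x => φ (Real.pi - x)) atTop
      (Set.Icc 0 Real.pi) := fun u hu => by
  filter_upwards [h u hu] with n hn x hx
  exact hn _ ⟨by linarith [hx.2], by linarith [hx.1]⟩

theorem TendstoUniformlyOn.comp_div_two {F : ℕ → ℝ → ℂ} {φ : ℝ → ℂ} {S : Set ℝ}
    (h : TendstoUniformlyOn F φ atTop S) :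
    TendstoUniformlyOn (fun n => F (n / 2)) φ atTop S := fun u hu =>
  (Nat.tendsto_div_const_atTop (n := 2) two_ne_zero).eventually (h u hu)

theorem TendstoUniformlyOn.continuous_mul {F : ℕ → ℝ → ℂ} {φ c : ℝ → ℂ} {S : Set ℝ}
    (hS : IsCompact S) (hc : Continuous c) (h : TendstoUniformlyOn F φ atTop S) :
    TendstoUniformlyOn (fun n x => c x * F n x) (fun x => c x * φ x) atTop S :=
  let ⟨_, hK⟩ := hS.exists_bound_of_continuousOn hc.continuousOn
  TendstoUniformlyOn.bounded_mul hK h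

/-- Pointwise convergence of spectral decompositions of the free Dirac
operator for strictly regular boundary conditions: for `f, g` of bounded variation,
continuous at `0` and `π`, the partial sums `S_M(x)` converge at every `x ∈ [0,π]`;
the limit is the half-sum of one-sided limits in the interior, and is given by explicit
boundary formulas at `x = 0, π`.  If moreover `f, g` are continuous on `[0,π]` and
satisfy the boundary conditions, the convergence is uniform on `[0,π]`. -/
theorem stmt18 (a b c d z₁ z₂ τ₁ τ₂ α₁ α₂ β₁ β₂ α₁' α₂' β₁' β₂' : ℂ)
    (hreg : b * c - a * d ≠ 0)
    (hsr : (b - c) ^ 2 + 4 * a * d ≠ 0)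
    (hz₁ : z₁ ^ 2 + (b + c) * z₁ + (b * c - a * d) = 0)
    (hz₂ : z₂ ^ 2 + (b + c) * z₂ + (b * c - a * d) = 0)
    (hzne : z₁ ≠ z₂)
    (hτ₁ : Complex.exp (Complex.I * Real.pi * τ₁) = z₁)
    (hτ₂ : Complex.exp (Complex.I * Real.pi * τ₂) = z₂)
    (hτre : |τ₁.re - τ₂.re| ≤ 1)
    (hα₁ : b * α₁ + a * α₂ = -z₁ * α₁) (hα₂ : d * α₁ + c * α₂ = -z₁ * α₂)
    (hβ₁ : b * β₁ + a * β₂ = -z₂ * β₁) (hβ₂ : d * β₁ + c * β₂ = -z₂ * β₂)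
    (hdet : α₁ * β₂ - α₂ * β₁ ≠ 0)
    (hinv₁ : α₁' * α₁ + α₂' * α₂ = 1) (hinv₂ : α₁' * β₁ + α₂' * β₂ = 0)
    (hinv₃ : β₁' * α₁ + β₂' * α₂ = 0) (hinv₄ : β₁' * β₁ + β₂' * β₂ = 1)
    (f g : ℝ → ℂ)
    (hfBV : BoundedVariationOn f (Set.Icc 0 Real.pi))
    (hgBV : BoundedVariationOn g (Set.Icc 0 Real.pi))
    (hf0 : ContinuousWithinAt f (Set.Icc 0 Real.pi) 0)
    (hfπ : ContinuousWithinAt f (Set.Icc 0 Real.pi) Real.pi)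
    (hg0 : ContinuousWithinAt g (Set.Icc 0 Real.pi) 0)
    (hgπ : ContinuousWithinAt g (Set.Icc 0 Real.pi) Real.pi) :
    -- interior points: convergence to the half-sum of the one-sided limits
    (∀ x ∈ Set.Ioo (0 : ℝ) Real.pi, ∃ fl fr gl gr : ℂ,
      Tendsto f (nhdsWithin x (Set.Ioo 0 x)) (nhds fl) ∧
      Tendsto f (nhdsWithin x (Set.Ioo x Real.pi)) (nhds fr) ∧
      Tendsto g (nhdsWithin x (Set.Ioo 0 x)) (nhds gl) ∧
      Tendsto g (nhdsWithin x (Set.Ioo x Real.pi)) (nhds gr) ∧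
      Tendsto (fun M : ℕ => SMsum α₁ α₂ β₁ β₂ α₁' α₂' β₁' β₂' τ₁ τ₂ f g M x) atTop
        (nhds ((fl + fr) / 2, (gl + gr) / 2))) ∧
    -- endpoint x = 0
    Tendsto (fun M : ℕ => SMsum α₁ α₂ β₁ β₂ α₁' α₂' β₁' β₂' τ₁ τ₂ f g M 0) atTop
      (nhds ((f 0 - b * f Real.pi - a * g 0) / 2,
        ((d / (b * c - a * d)) * f 0 + g 0 - (b / (b * c - a * d)) * g Real.pi) / 2)) ∧
    -- endpoint x = π
    Tendsto (fun M : ℕ => SMsum α₁ α₂ β₁ β₂ α₁' α₂' β₁' β₂' τ₁ τ₂ f g M Real.pi) atTop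
      (nhds ((-(c / (b * c - a * d)) * f 0 + f Real.pi + (a / (b * c - a * d)) * g Real.pi) / 2,
        (-d * f Real.pi - c * g 0 + g Real.pi) / 2)) ∧
    -- uniform convergence under continuity and the boundary conditions
    ((ContinuousOn f (Set.Icc 0 Real.pi) → ContinuousOn g (Set.Icc 0 Real.pi) →
      f 0 + b * f Real.pi + a * g 0 = 0 → d * f Real.pi + c * g 0 + g Real.pi = 0 →
      TendstoUniformlyOn (fun M x => SMsum α₁ α₂ β₁ β₂ α₁' α₂' β₁' β₂' τ₁ τ₂ f g M x)
        (fun x => (f x, g x)) atTop (Set.Icc 0 Real.pi))) := by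
  have hz₁0 : z₁ ≠ 0 := hτ₁ ▸ Complex.exp_ne_zero _
  have hz₂0 : z₂ ≠ 0 := hτ₂ ▸ Complex.exp_ne_zero _
  have hM : !![α₁, β₁; α₂, β₂] * !![α₁', α₂'; β₁', β₂'] = 1 := by
    rw [mul_eq_one_comm, Matrix.mul_fin_two, Matrix.one_fin_two, hinv₁, hinv₂, hinv₃, hinv₄]
  rw [Matrix.mul_fin_two, Matrix.one_fin_two] at hM
  have h11 : α₁ * α₁' + β₁ * β₁' = 1 := congrFun (congrFun hM 0) 0
  have h12 : α₁ * α₂' + β₁ * β₂' = 0 := congrFun (congrFun hM 0) 1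
  have h21 : α₂ * α₁' + β₂ * β₁' = 0 := congrFun (congrFun hM 1) 0
  have h22 : α₂ * α₂' + β₂ * β₂' = 1 := congrFun (congrFun hM 1) 1
  clear hM
  have hb : z₁ * α₁ * α₁' + z₂ * β₁ * β₁' = -b := by
    linear_combination α₁' * hα₁ + β₁' * hβ₁ - b * h11 - a * h21
  have ha : z₁ * α₁ * α₂' + z₂ * β₁ * β₂' = -a := by
    linear_combination α₂' * hα₁ + β₂' * hβ₁ - b * h12 - a * h22
  have hd : z₁ * α₂ * α₁' + z₂ * β₂ * β₁' = -d := by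
    linear_combination α₁' * hα₂ + β₁' * hβ₂ - d * h11 - c * h21
  have hc : z₁ * α₂ * α₂' + z₂ * β₂ * β₂' = -c := by
    linear_combination α₂' * hα₂ + β₂' * hβ₂ - d * h12 - c * h22
  -- the inverse of the boundary matrix on its eigenvectors
  have hα₂i : z₁⁻¹ * α₂ = (d * α₁ - b * α₂) / (b * c - a * d) := by
    rw [eq_div_iff hreg]
    field_simp
    linear_combination b * hα₂ - d * hα₁
  have hα₁i : z₁⁻¹ * α₁ = (a * α₂ - c * α₁) / (b * c - a * d) := by
    rw [eq_div_iff hreg]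
    field_simp
    linear_combination c * hα₁ - a * hα₂
  have hβ₂i : z₂⁻¹ * β₂ = (d * β₁ - b * β₂) / (b * c - a * d) := by
    rw [eq_div_iff hreg]
    field_simp
    linear_combination b * hβ₂ - d * hβ₁
  have hβ₁i : z₂⁻¹ * β₁ = (a * β₂ - c * β₁) / (b * c - a * d) := by
    rw [eq_div_iff hreg]
    field_simp
    linear_combination c * hβ₁ - a * hβ₂
  have hfi := hfBV.intervalIntegrable_complex Real.pi_pos.le
  have hgi := hgBV.intervalIntegrable_complex Real.pi_pos.le
  have hE₁ : Complex.exp (Complex.I * τ₁ * Real.pi) = z₁ := by rw [← hτ₁, mul_right_comm]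
  have hE₂ : Complex.exp (Complex.I * τ₂ * Real.pi) = z₂ := by rw [← hτ₂, mul_right_comm]
  have hL₁ := tendsto_expSum_branchFun_zero (p := α₁') (q := α₂') (τ := τ₁)
    hfBV hgBV hf0 hfπ hg0 hgπ
  have hL₂ := tendsto_expSum_branchFun_zero (p := β₁') (q := β₂') (τ := τ₂)
    hfBV hgBV hf0 hfπ hg0 hgπ
  rw [hτ₁] at hL₁
  rw [hτ₂] at hL₂
  have hcancel : ∀ w : ℂ, Complex.exp w * Complex.exp (-w) = 1 := fun w => by
    rw [← Complex.exp_add, add_neg_cancel, Complex.exp_zero]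
  refine ⟨fun x hx => ?_, ?_, ?_, fun hfc hgc hbc₁ hbc₂ => ?_⟩
  · have hx' : Real.pi - x ∈ Set.Ioo 0 Real.pi := ⟨by linarith [hx.2], by linarith [hx.1]⟩
    have hxx : Real.pi - (Real.pi - x) = x := by ring
    obtain ⟨fl, fr, hfl, hfr⟩ := hfBV.exists_tendsto_Ioo hx
    obtain ⟨gl, gr, hgl, hgr⟩ := hgBV.exists_tendsto_Ioo hx
    obtain ⟨fl', fr', hfl', hfr'⟩ := hfBV.exists_tendsto_Ioo hx'
    obtain ⟨gl', gr', hgl', hgr'⟩ := hgBV.exists_tendsto_Ioo hx'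
    refine ⟨fl, fr, gl, gr, hfl, hfr, hgl, hgr, ?_⟩
    have key := tendsto_SMsum (α₁ := α₁) (α₂ := α₂) (β₁ := β₁) (β₂ := β₂) (α₁' := α₁')
      (α₂' := α₂') (β₁' := β₁') (β₂' := β₂') (τ₁ := τ₁) (τ₂ := τ₂) hfi hgi
      (tendsto_expSum_branchFun_of_mem_Ioo hfBV hgBV hx hfl hfr hgl' hgr')
      (tendsto_expSum_branchFun_of_mem_Ioo hfBV hgBV hx hfl hfr hgl' hgr')
      (tendsto_expSum_branchFun_of_mem_Ioo hfBV hgBV hx' hfl' hfr' (hxx.symm ▸ hgl)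
        (hxx.symm ▸ hgr))
      (tendsto_expSum_branchFun_of_mem_Ioo hfBV hgBV hx' hfl' hfr' (hxx.symm ▸ hgl)
        (hxx.symm ▸ hgr))
    convert key using 3
    · linear_combination (-(fl + fr) / 2) * h11 - (gl' + gr') / 2 * h12 -
        α₁ * (α₁' * ((fl + fr) / 2) + α₂' * ((gl' + gr') / 2)) *
          hcancel (Complex.I * τ₁ * ((Real.pi : ℂ) - x)) -
        β₁ * (β₁' * ((fl + fr) / 2) + β₂' * ((gl' + gr') / 2)) *
          hcancel (Complex.I * τ₂ * ((Real.pi : ℂ) - x))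
    · rw [Complex.ofReal_sub, sub_sub_cancel]
      linear_combination (-(fl' + fr') / 2) * h21 - (gl + gr) / 2 * h22 -
        α₂ * (α₁' * ((fl' + fr') / 2) + α₂' * ((gl + gr) / 2)) *
          hcancel (Complex.I * τ₁ * x) -
        β₂ * (β₁' * ((fl' + fr') / 2) + β₂' * ((gl + gr) / 2)) *
          hcancel (Complex.I * τ₂ * x)
  · have key := tendsto_SMsum (α₁ := α₁) (α₂ := α₂) (β₁ := β₁) (β₂ := β₂) hfi hgi hL₁ hL₂
      (by simpa only [sub_zero, expSum_pi] using hL₁)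
      (by simpa only [sub_zero, expSum_pi] using hL₂)
    simp only [Complex.ofReal_zero, sub_zero, mul_zero, Complex.exp_zero, mul_one, hE₁, hE₂] at key
    convert key using 3
    · field_simp
      linear_combination -f 0 * h11 - g Real.pi * h12 - f Real.pi * hb - g 0 * ha
    · linear_combination (-f 0 / 2 * α₁' - g Real.pi / 2 * α₂') * hα₂i +
        (-f 0 / 2 * β₁' - g Real.pi / 2 * β₂') * hβ₂i - f Real.pi / 2 * h21 - g 0 / 2 * h22 -
        f 0 / 2 / (b * c - a * d) * (d * h11 - b * h21) -
        g Real.pi / 2 / (b * c - a * d) * (d * h12 - b * h22)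
  · have key := tendsto_SMsum (α₁ := α₁) (α₂ := α₂) (β₁ := β₁) (β₂ := β₂) (x := Real.pi) hfi hgi
      (by simpa only [expSum_pi] using hL₁) (by simpa only [expSum_pi] using hL₂)
      (by simpa only [sub_self] using hL₁) (by simpa only [sub_self] using hL₂)
    simp only [sub_self, mul_zero, Complex.exp_zero, mul_one, hE₁, hE₂] at key
    convert key using 3
    · linear_combination (-f 0 / 2 * α₁' - g Real.pi / 2 * α₂') * hα₁i +
        (-f 0 / 2 * β₁' - g Real.pi / 2 * β₂') * hβ₁i - f Real.pi / 2 * h11 - g 0 / 2 * h12 -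
        f 0 / 2 / (b * c - a * d) * (a * h21 - c * h11) -
        g Real.pi / 2 / (b * c - a * d) * (a * h22 - c * h12)
    · field_simp
      linear_combination -f 0 * h21 - g Real.pi * h22 - f Real.pi * hd - g 0 * hc
  · have hU₁ : TendstoUniformlyOn (expSum (branchFun α₁' α₂' τ₁ f g)) (branchFun α₁' α₂' τ₁ f g)
        atTop (Set.Icc 0 Real.pi) :=
      tendstoUniformlyOn_expSum_branchFun hfBV hgBV hfc hgc (by
        rw [hτ₁]
        linear_combination α₁' * hbc₁ + α₂' * hbc₂ -
          f Real.pi * (α₁' * hb + α₂' * hd - z₁ * α₁' * hinv₁ - z₂ * β₁' * hinv₂) -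
          g 0 * (α₁' * ha + α₂' * hc - z₁ * α₂' * hinv₁ - z₂ * β₂' * hinv₂))
    have hU₂ : TendstoUniformlyOn (expSum (branchFun β₁' β₂' τ₂ f g)) (branchFun β₁' β₂' τ₂ f g)
        atTop (Set.Icc 0 Real.pi) :=
      tendstoUniformlyOn_expSum_branchFun hfBV hgBV hfc hgc (by
        rw [hτ₂]
        linear_combination β₁' * hbc₁ + β₂' * hbc₂ -
          f Real.pi * (β₁' * hb + β₂' * hd - z₁ * α₁' * hinv₃ - z₂ * β₁' * hinv₄) -
          g 0 * (β₁' * ha + β₂' * hc - z₁ * α₂' * hinv₃ - z₂ * β₂' * hinv₄))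
    have hu := isCompact_Icc (a := (0 : ℝ)) (b := Real.pi)
    have hV := ((hU₁.comp_div_two.continuous_mul hu (c := fun x : ℝ =>
        α₁ * Complex.exp (Complex.I * τ₁ * ((Real.pi : ℂ) - x))) (by fun_prop)).add
      (hU₂.comp_div_two.continuous_mul hu (c := fun x : ℝ =>
        β₁ * Complex.exp (Complex.I * τ₂ * ((Real.pi : ℂ) - x))) (by fun_prop))).prodMk
      ((hU₁.comp_pi_sub.comp_div_two.continuous_mul hu (c := fun x : ℝ =>
        α₂ * Complex.exp (Complex.I * τ₁ * x)) (by fun_prop)).add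
      (hU₂.comp_pi_sub.comp_div_two.continuous_mul hu (c := fun x : ℝ =>
        β₂ * Complex.exp (Complex.I * τ₂ * x)) (by fun_prop)))
    have hW := TendstoUniformlyOn.congr_right (g := fun x => (f x, g x))
      (fun u hu => tendsto_diag.eventually (hV u hu)) (fun x _ => ?_)
    · refine hW.congr (Eventually.of_forall fun M x _ => ?_)
      exact (SMsum_eq _ _ _ _ _ _ _ _ _ _ hfi hgi M x).symm
    · simp only [Pi.add_apply, branchFun, Complex.ofReal_sub, sub_sub_cancel]
      ext
      · linear_combination f x * h11 + g (Real.pi - x) * h12 +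
          α₁ * (α₁' * f x + α₂' * g (Real.pi - x)) *
            hcancel (Complex.I * τ₁ * ((Real.pi : ℂ) - x)) +
          β₁ * (β₁' * f x + β₂' * g (Real.pi - x)) *
            hcancel (Complex.I * τ₂ * ((Real.pi : ℂ) - x))
      · linear_combination f (Real.pi - x) * h21 + g x * h22 +
          α₂ * (α₁' * f (Real.pi - x) + α₂' * g x) * hcancel (Complex.I * τ₁ * x) +
          β₂ * (β₁' * f (Real.pi - x) + β₂' * g x) * hcancel (Complex.I * τ₂ * x)
end
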